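/- arXiv:1005.4736 — 2 statements merged into one kernel-verified Lean document; each statement's English description precedes it below -/
import Mathlib

section
/- Every free group (absolutely free group of arbitrary rank) is n-element order separable for every positive integer n. -/
/-- A group `G` is `n`-element order separable if for all elements `u 0, ..., u (n-1)` of `G`
such that for `i ≠ j` the element `u i` is conjugate neither to `u j` nor to `(u j)⁻¹`,
there is a homomorphism of `G` onto a finite group under which the orders of the images
of the `u i` are pairwise different. -/
def OrderSeparable (G : Type*) [Group G] (n : ℕ) : Prop :=
  ∀ u : Fin n → G,
    (∀ i j, i ≠ j → ¬ IsConj (u i) (u j) ∧ ¬ IsConj (u i) (u j)⁻¹) →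
    ∃ (H : Type) (_ : Group H) (_ : Finite H) (φ : G →* H),
      Function.Surjective φ ∧
      ∀ i j, i ≠ j → orderOf (φ (u i)) ≠ orderOf (φ (u j))

namespace FreeGroup

universe u

variable {α : Type u}

/-- A free group action restricted to a finite subset extends to an action on that subset which
agrees with the original one wherever a generator does not leave the subset. -/
theorem exists_permHom_of_finite {Y : Type*} [MulAction (FreeGroup α) Y] (T : Set Y) [Finite T] :
    ∃ φ : FreeGroup α →* Equiv.Perm T,
      ∀ (x : α) (s t : T), of x • (s : Y) = t → φ (of x) s = t := by
  have h : ∀ x : α, ∃ σ : Equiv.Perm T, ∀ s t : T, of x • (s : Y) = t → σ s = t := by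
    intro x
    let D := {s : T // of x • (s : Y) ∈ T}
    obtain ⟨σ, hσ⟩ := Equiv.Perm.exists_extending_pair (fun s : D => s.1)
      (fun s : D => (⟨of x • (s.1 : Y), s.2⟩ : T)) Subtype.val_injective (by
        intro a b hab
        have h := congrArg Subtype.val hab
        exact Subtype.ext (Subtype.ext (MulAction.injective _ h)))
    refine ⟨σ, fun s t hst => ?_⟩
    have hs : of x • (s : Y) ∈ T := hst ▸ t.2
    exact (hσ (⟨s, hs⟩ : D)).trans (Subtype.ext hst)
  choose σ hσ using h
  exact ⟨lift σ, fun x s t hst => by simpa using hσ x s t hst⟩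

theorem mk_cons_eq_mul (a : α × Bool) (L : List (α × Bool)) : mk (a :: L) = mk [a] * mk L := by
  simp

theorem mk_singleton_false (x : α) : mk [(x, false)] = (of x)⁻¹ := rfl

theorem mk_singleton_true (x : α) : mk [(x, true)] = of x := rfl

theorem permHom_mk_apply {Y : Type*} [MulAction (FreeGroup α) Y] {T : Set Y}
    {φ : FreeGroup α →* Equiv.Perm T}
    (hφ : ∀ (x : α) (s t : T), of x • (s : Y) = t → φ (of x) s = t) (o : T) :
    ∀ L : List (α × Bool), (∀ L', L' <:+ L → mk L' • (o : Y) ∈ T) →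
      (φ (mk L) o : Y) = mk L • (o : Y)
  | [], _ => by simp [← one_eq_mk]
  | (x, b) :: L, h => by
    have ih := permHom_mk_apply hφ o L fun L' hL' => h L' (hL'.trans (L.suffix_cons _))
    have hmem := h _ List.suffix_rfl
    rw [mk_cons_eq_mul, mul_smul, ← ih] at hmem ⊢
    rw [_root_.map_mul, Equiv.Perm.mul_apply]
    cases b
    · rw [mk_singleton_false] at hmem ⊢
      have := hφ x ⟨_, hmem⟩ (φ (mk L) o) (by simp)
      rw [_root_.map_inv, Equiv.Perm.inv_eq_iff_eq.2 this.symm]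
    · rw [mk_singleton_true] at hmem ⊢
      rw [hφ x (φ (mk L) o) ⟨_, hmem⟩ rfl]

/-- Cyclic subgroups of a free group are separable. -/
theorem exists_finite_notMem_zpowers {w h : FreeGroup α} (hw : h ∉ Subgroup.zpowers w) :
    ∃ (H : Type u) (_ : Group H) (_ : Finite H) (φ : FreeGroup α →* H),
      φ h ∉ Subgroup.zpowers (φ w) := by
  classical
  let o : FreeGroup α ⧸ Subgroup.zpowers w := (1 : FreeGroup α)
  let S : Set (List (α × Bool)) := {L | L <:+ w.toWord} ∪ {L | L <:+ h.toWord}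
  have hS : S.Finite := by
    refine Set.Finite.union ?_ ?_
    · exact (List.finite_toSet w.toWord.tails).subset fun L hL => by simpa using hL
    · exact (List.finite_toSet h.toWord.tails).subset fun L hL => by simpa using hL
  let T : Set (FreeGroup α ⧸ Subgroup.zpowers w) := (fun L => mk L • o) '' S
  have : Finite T := (hS.image _).to_subtype
  have ho : o ∈ T := ⟨[], Or.inl (List.nil_suffix), by simp [← one_eq_mk]⟩
  obtain ⟨φ, hφ⟩ := exists_permHom_of_finite (α := α) T
  have key : ∀ g : FreeGroup α, {L | L <:+ g.toWord} ⊆ S →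
      ((φ g ⟨o, ho⟩ : T) : FreeGroup α ⧸ Subgroup.zpowers w) = g • o := by
    intro g hg
    have := permHom_mk_apply hφ ⟨o, ho⟩ g.toWord fun L' hL' => ⟨L', hg hL', rfl⟩
    simpa [mk_toWord] using this
  have hwo : φ w ⟨o, ho⟩ = ⟨o, ho⟩ := by
    refine Subtype.ext ((key w Set.subset_union_left).trans ?_)
    change ((w * 1 : FreeGroup α) : FreeGroup α ⧸ Subgroup.zpowers w) = (1 : FreeGroup α)
    rw [QuotientGroup.eq]
    simp
  refine ⟨Equiv.Perm T, inferInstance, inferInstance, φ, fun hmem => hw ?_⟩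
  obtain ⟨k, hk⟩ := hmem
  have h1 : φ h ⟨o, ho⟩ = ⟨o, ho⟩ := by
    rw [← hk]
    exact Equiv.Perm.zpow_apply_eq_self_of_apply_eq_self hwo k
  have h2 : h • o = o := (key h Set.subset_union_right).symm.trans (congrArg Subtype.val h1)
  have h3 : ((h * 1 : FreeGroup α) : FreeGroup α ⧸ Subgroup.zpowers w) = (1 : FreeGroup α) := h2
  rw [QuotientGroup.eq] at h3
  simpa using h3

theorem exists_finite_forall_notMem_zpowers (s : Set (FreeGroup α × FreeGroup α)) (hs : s.Finite)
    (h : ∀ a ∈ s, a.2 ∉ Subgroup.zpowers a.1) :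
    ∃ (H : Type u) (_ : Group H) (_ : Finite H) (φ : FreeGroup α →* H),
      ∀ a ∈ s, φ a.2 ∉ Subgroup.zpowers (φ a.1) := by
  have : Finite s := hs
  choose H hH hfin φ hφ using fun a : s => exists_finite_notMem_zpowers (h a.1 a.2)
  refine ⟨∀ a, H a, inferInstance, inferInstance, MonoidHom.pi φ, fun a ha hmem => ?_⟩
  obtain ⟨k, hk⟩ := hmem
  exact hφ ⟨a, ha⟩ ⟨k, by simpa using congrFun hk ⟨a, ha⟩⟩

/-- An infinite word of period `l` without cancellation. -/
structure IsPeriodicWord (y : ℕ → α × Bool) (l : ℕ) : Prop where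
  pos : 0 < l
  periodic : ∀ n, y (n + l) = y n
  reduced : ∀ n, y (n + 1) ≠ ((y n).1, !(y n).2)

/-- The product of the first `n` letters of `y`, later letters on the left. -/
def partialProd (y : ℕ → α × Bool) : ℕ → FreeGroup α
  | 0 => 1
  | n + 1 => mk [y n] * partialProd y n

/-- The word spelled by the first `n` letters of `y`, later letters on the left. -/
def partialWord (y : ℕ → α × Bool) : ℕ → List (α × Bool)
  | 0 => []
  | n + 1 => y n :: partialWord y n

theorem mk_partialWord (y : ℕ → α × Bool) : ∀ n, mk (partialWord y n) = partialProd y n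
  | 0 => rfl
  | n + 1 => by rw [partialWord, mk_cons_eq_mul, mk_partialWord y n, partialProd]

theorem length_partialWord (y : ℕ → α × Bool) : ∀ n, (partialWord y n).length = n
  | 0 => rfl
  | n + 1 => by rw [partialWord, List.length_cons, length_partialWord y n]

theorem partialProd_add (y : ℕ → α × Bool) (m : ℕ) :
    ∀ n, partialProd y (n + m) = partialProd (fun k => y (k + m)) n * partialProd y m
  | 0 => by simp [partialProd]
  | n + 1 => by
    rw [Nat.add_right_comm, partialProd, partialProd_add y m n, partialProd, mul_assoc]

namespace IsPeriodicWord

variable {y y' : ℕ → α × Bool} {l l' : ℕ}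

theorem isReduced_partialWord (h : IsPeriodicWord y l) : ∀ n, IsReduced (partialWord y n)
  | 0 => IsReduced.nil
  | 1 => IsReduced.singleton
  | n + 2 => by
    rw [partialWord, partialWord, isReduced_cons_cons]
    refine ⟨fun h1 => ?_, h.isReduced_partialWord (n + 1)⟩
    by_contra h2
    exact h.reduced n (Prod.ext h1 (by simpa [Bool.eq_not] using h2))

theorem partialProd_injective (h : IsPeriodicWord y l) : Function.Injective (partialProd y) := by
  classical
  intro m n hmn
  rw [← mk_partialWord, ← mk_partialWord] at hmn
  have := congrArg List.length (reduce.sound hmn)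
  rwa [(h.isReduced_partialWord m).reduce_eq, (h.isReduced_partialWord n).reduce_eq,
    length_partialWord, length_partialWord] at this

theorem periodic_mul (h : IsPeriodicWord y l) (n : ℕ) : ∀ k, y (n + l * k) = y n
  | 0 => rfl
  | k + 1 => by rw [mul_add, mul_one, ← add_assoc, h.periodic, h.periodic_mul n k]

theorem partialProd_add_mul (h : IsPeriodicWord y l) (n : ℕ) :
    ∀ k, partialProd y (n + l * k) = partialProd y n * partialProd y l ^ k := by
  have h1 : ∀ n, partialProd y (n + l) = partialProd y n * partialProd y l := fun n => by
    rw [partialProd_add]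
    simp only [h.periodic]
  intro k
  induction k with
  | zero => simp
  | succ k ih => rw [mul_add, mul_one, ← add_assoc, h1, ih, pow_succ, mul_assoc]

theorem partialProd_mul (h : IsPeriodicWord y l) (k : ℕ) :
    partialProd y (l * k) = partialProd y l ^ k := by
  simpa [partialProd] using h.partialProd_add_mul 0 k

theorem notMem_zpowers (h : IsPeriodicWord y l) {i j : ℕ} (hi : i < l) (hj : j < l)
    (hij : i ≠ j) :
    (partialProd y j)⁻¹ * partialProd y i ∉ Subgroup.zpowers (partialProd y l) := by
  have key : ∀ i j : ℕ, i < l → j < l → ∀ k : ℕ,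
      partialProd y j * partialProd y l ^ k = partialProd y i → i = j := by
    intro i j hi hj k hk
    rw [← h.partialProd_add_mul] at hk
    have := h.partialProd_injective hk
    rcases Nat.eq_zero_or_pos k with rfl | hk0
    · simpa using this.symm
    · have := Nat.le_mul_of_pos_right l hk0
      omega
  rintro ⟨k, hk⟩
  have hk : partialProd y j * partialProd y l ^ k = partialProd y i := by
    rw [eq_inv_mul_iff_mul_eq] at hk
    exact hk
  obtain ⟨k, rfl | rfl⟩ := k.eq_nat_or_neg
  · exact hij (key i j hi hj k (by simpa using hk))
  · refine hij (key j i hj hi k ?_).symm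
    rw [← hk]
    simp

/-- If two periodic words have a common tail, some powers of their periods are conjugate. -/
theorem isConj_of_shift (h : IsPeriodicWord y l) (h' : IsPeriodicWord y' l') (m : ℕ)
    (hm : ∀ n, y' n = y (n + m)) :
    IsConj (partialProd y l ^ l') (partialProd y' l' ^ l) := by
  have h1 := partialProd_add y m (l * l')
  rw [add_comm, h.partialProd_add_mul, ← funext hm, mul_comm l l', h'.partialProd_mul] at h1
  exact isConj_iff.2 ⟨partialProd y m, by rw [h1, mul_inv_cancel_right]⟩

end IsPeriodicWord

theorem exists_isPeriodicWord {L : List (α × Bool)} (hL : IsCyclicallyReduced L) (hne : L ≠ []) :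
    ∃ y, IsPeriodicWord y L.length ∧ partialProd y L.length = mk L := by
  have hpos : 0 < L.length := List.length_pos_iff.2 hne
  let y : ℕ → α × Bool := fun n => L[L.length - 1 - n % L.length]'(by omega)
  have hy : ∀ n, ∀ k (hk : k < L.length), L.length - 1 - n % L.length = k → y n = L[k] := by
    rintro n k hk rfl
    rfl
  have hred := List.isChain_iff_getElem.1 hL.1
  refine ⟨y, ⟨hpos, fun n => by simp [y], fun n hn => ?_⟩, ?_⟩
  · have hlt := Nat.mod_lt n hpos
    by_cases hlast : n % L.length + 1 < L.length
    · have h1 : (n + 1) % L.length = n % L.length + 1 := by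
        rw [← Nat.mod_add_mod, Nat.mod_eq_of_lt hlast]
      have := hred (L.length - 1 - (n + 1) % L.length) (by omega)
      rw [← hy (n + 1) _ (by omega) rfl, ← hy n _ (by omega) (by omega), hn] at this
      simp at this
    · have h1 : (n + 1) % L.length = 0 := by
        rw [← Nat.mod_add_mod, show n % L.length + 1 = L.length by omega, Nat.mod_self]
      have e1 : y (n + 1) = L[L.length - 1] := hy _ _ (by omega) (by omega)
      have e2 : y n = L[0] := hy _ _ (by omega) (by omega)
      have := hL.2 (y (n + 1)) (by rw [e1, List.getLast?_eq_getElem?]; simp [hpos])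
        (y n) (by rw [e2, List.head?_eq_getElem?]; simp [hpos])
      rw [hn] at this
      simp at this
  · have key : ∀ n ≤ L.length, partialProd y n = mk (L.drop (L.length - n)) := by
      intro n
      induction n with
      | zero => intro _; simp [partialProd, one_eq_mk]
      | succ n ih =>
        intro hn
        rw [partialProd, ih (by omega),
          List.drop_eq_getElem_cons (i := L.length - (n + 1)) (by omega),
          mk_cons_eq_mul _ (L.drop _), show L.length - (n + 1) + 1 = L.length - n by omega,
          hy n (L.length - (n + 1)) (by omega) (by rw [Nat.mod_eq_of_lt (by omega)]; omega)]
    simpa using key L.length le_rfl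

theorem IsCyclicallyReduced.invRev {L : List (α × Bool)} (hL : IsCyclicallyReduced L) :
    IsCyclicallyReduced (invRev L) := by
  classical
  refine ⟨.of_reduce_eq (by rw [reduce_invRev, hL.1.reduce_eq]), ?_⟩
  intro a ha b hb hab
  simp only [FreeGroup.invRev, List.getLast?_reverse, List.head?_reverse, List.head?_map,
    List.getLast?_map, Option.mem_def, Option.map_eq_some_iff] at ha hb
  obtain ⟨a, ha, rfl⟩ := ha
  obtain ⟨b, hb, rfl⟩ := hb
  simp [hL.2 b hb a ha hab.symm]

/-- Every nontrivial element is conjugate to the period of a periodic word, whose inverse is also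
the period of a periodic word. -/
theorem exists_isConj_partialProd {g : FreeGroup α} (hg : g ≠ 1) :
    ∃ y y' l, IsPeriodicWord y l ∧ IsPeriodicWord y' l ∧ IsConj g (partialProd y l) ∧
      partialProd y' l = (partialProd y l)⁻¹ := by
  classical
  set L := reduceCyclically g.toWord with hLdef
  have hL : IsCyclicallyReduced L := reduceCyclically.isCyclicallyReduced isReduced_toWord
  have hconj : mk (reduceCyclically.conjugator g.toWord) * mk L *
      (mk (reduceCyclically.conjugator g.toWord))⁻¹ = g := by
    rw [inv_mk, mul_mk, mul_mk, reduceCyclically.conj_conjugator_reduceCyclically, mk_toWord]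
  have hne : L ≠ [] := by
    intro h
    rw [h, ← one_eq_mk] at hconj
    exact hg (by rw [← hconj, mul_one, mul_inv_cancel])
  obtain ⟨y, hy, hyL⟩ := exists_isPeriodicWord hL hne
  obtain ⟨y', hy', hyL'⟩ := exists_isPeriodicWord hL.invRev (by simpa [invRev] using hne)
  rw [invRev_length] at hy' hyL'
  refine ⟨y, y', L.length, hy, hy', ?_, by rw [hyL, hyL', inv_mk]⟩
  rw [hyL]
  exact (isConj_iff.2 ⟨_, hconj⟩).symm

/-! ### Skew products -/

section Skew

variable {S A : Type*} [AddCommGroup A]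

/-- The permutation of `S × A` lying over `π` which translates the fibre over `s` by `f s`. -/
def skewPerm (π : Equiv.Perm S) (f : S → A) : Equiv.Perm (S × A) where
  toFun q := (π q.1, q.2 + f q.1)
  invFun q := (π.symm q.1, q.2 - f (π.symm q.1))
  left_inv q := by simp
  right_inv q := by simp

/-- The action on `S × A` over `ρ` in which the generator `x` translates the fibre over `s` by
`ψ (x, s)`. -/
def skewHom (ρ : FreeGroup α →* Equiv.Perm S) (ψ : α × S → A) :
    FreeGroup α →* Equiv.Perm (S × A) :=
  lift fun x => skewPerm (ρ (of x)) fun s => ψ (x, s)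

/-- The translation by which `f` moves the fibre over `s` in `skewHom ρ ψ`. -/
def cocycle (ρ : FreeGroup α →* Equiv.Perm S) (ψ : α × S → A) (f : FreeGroup α) (s : S) : A :=
  (skewHom ρ ψ f (s, 0)).2

variable (ρ : FreeGroup α →* Equiv.Perm S) (ψ : α × S → A)

theorem skewHom_of_apply (x : α) (s : S) (a : A) :
    skewHom ρ ψ (of x) (s, a) = (ρ (of x) s, a + ψ (x, s)) := by
  simp [skewHom, skewPerm]

theorem skewHom_apply (f : FreeGroup α) (s : S) (a : A) :
    skewHom ρ ψ f (s, a) = (ρ f s, a + cocycle ρ ψ f s) := by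
  have key : ∃ c : S → A, ∀ s a, skewHom ρ ψ f (s, a) = (ρ f s, a + c s) := by
    induction f using FreeGroup.induction_on with
    | C1 => exact ⟨0, by simp⟩
    | of x => exact ⟨fun s => ψ (x, s), skewHom_of_apply ρ ψ x⟩
    | inv_of x _ =>
      refine ⟨fun s => -ψ (x, (ρ (of x))⁻¹ s), fun s a => ?_⟩
      rw [_root_.map_inv, Equiv.Perm.inv_eq_iff_eq, skewHom_of_apply]
      simp
    | mul f g hf hg =>
      obtain ⟨c, hc⟩ := hf
      obtain ⟨d, hd⟩ := hg
      refine ⟨fun s => d s + c (ρ g s), fun s a => ?_⟩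
      rw [_root_.map_mul, Equiv.Perm.mul_apply, hd, hc, _root_.map_mul, Equiv.Perm.mul_apply,
        add_assoc]
  obtain ⟨c, hc⟩ := key
  simp [cocycle, hc]

theorem cocycle_of (x : α) (s : S) : cocycle ρ ψ (of x) s = ψ (x, s) := by
  simp [cocycle, skewHom_of_apply]

theorem cocycle_mul (f g : FreeGroup α) (s : S) :
    cocycle ρ ψ (f * g) s = cocycle ρ ψ g s + cocycle ρ ψ f (ρ g s) := by
  rw [cocycle, _root_.map_mul, Equiv.Perm.mul_apply, skewHom_apply, skewHom_apply, zero_add]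

theorem cocycle_one (s : S) : cocycle ρ ψ 1 s = 0 := by
  simp [cocycle]

theorem cocycle_inv (f : FreeGroup α) (s : S) :
    cocycle ρ ψ f⁻¹ s = -cocycle ρ ψ f ((ρ f)⁻¹ s) := by
  have := cocycle_mul ρ ψ f f⁻¹ s
  rw [mul_inv_cancel, cocycle_one, _root_.map_inv] at this
  exact eq_neg_of_add_eq_zero_left this.symm

variable {ρ}

theorem cocycle_pow {f : FreeGroup α} {s : S} (h : ρ f s = s) (n : ℕ) :
    cocycle ρ ψ (f ^ n) s = n • cocycle ρ ψ f s := by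
  induction n with
  | zero => simp [cocycle_one]
  | succ n ih => rw [pow_succ, cocycle_mul, h, ih, succ_nsmul, add_comm]

theorem cocycle_conj_of_fixed {f g : FreeGroup α} (hfg : Commute f g) {s : S} (h : ρ f s = s) :
    cocycle ρ ψ f (ρ g s) = cocycle ρ ψ f s := by
  have h1 := cocycle_mul ρ ψ f g s
  rw [hfg.eq, cocycle_mul, h, add_comm] at h1
  exact (add_left_cancel h1).symm

theorem cocycle_comp {T : S → S} (hT : ∀ x s, ρ (of x) (T s) = T (ρ (of x) s))
    (f : FreeGroup α) (s : S) :
    cocycle ρ (fun e => ψ (e.1, T e.2)) f s = cocycle ρ ψ f (T s) := by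
  have hT' : ∀ f s, ρ f (T s) = T (ρ f s) := by
    intro f
    induction f using FreeGroup.induction_on with
    | C1 => simp
    | of x => exact hT x
    | inv_of x h =>
      intro s
      rw [_root_.map_inv, Equiv.Perm.inv_eq_iff_eq, h]
      simp
    | mul f g hf hg => intro s; simp [hf, hg]
  induction f using FreeGroup.induction_on generalizing s with
  | C1 => simp [cocycle_one]
  | of x => simp [cocycle_of]
  | inv_of x _ =>
    rw [cocycle_inv, cocycle_inv, cocycle_of, cocycle_of, ← _root_.map_inv, hT']
  | mul f g hf hg => rw [cocycle_mul, cocycle_mul, hf, hg, hT']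

theorem cocycle_add (ψ' : α × S → A) (f : FreeGroup α) (s : S) :
    cocycle ρ (ψ + ψ') f s = cocycle ρ ψ f s + cocycle ρ ψ' f s := by
  induction f using FreeGroup.induction_on generalizing s with
  | C1 => simp [cocycle_one]
  | of x => simp [cocycle_of]
  | inv_of x h => simp [cocycle_inv, cocycle_of, add_comm]
  | mul f g hf hg => simp only [cocycle_mul, hf, hg]; abel

theorem cocycle_smul {K : Type*} [Ring K] [Module K A] (c : K) (f : FreeGroup α) (s : S) :
    cocycle ρ (c • ψ) f s = c • cocycle ρ ψ f s := by
  induction f using FreeGroup.induction_on generalizing s with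
  | C1 => simp [cocycle_one]
  | of x => simp [cocycle_of]
  | inv_of x h => simp [cocycle_inv, cocycle_of]
  | mul f g hf hg => simp only [cocycle_mul, hf, hg, smul_add]

variable (ρ) in
/-- The cocycle as a linear function of the values on the generators. -/
def cocycleLinear (K : Type*) [CommRing K] (f : FreeGroup α) (s : S) : (α × S → K) →ₗ[K] K where
  toFun ψ := cocycle ρ ψ f s
  map_add' ψ ψ' := cocycle_add ψ ψ' f s
  map_smul' c ψ := cocycle_smul ψ c f s

@[simp]
theorem cocycleLinear_apply (K : Type*) [CommRing K] (f : FreeGroup α) (s : S) (ψ : α × S → K) :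
    cocycleLinear ρ K f s ψ = cocycle ρ ψ f s := rfl

end Skew

/-! ### Simple closed lines -/

section Line

variable {S : Type*}

/-- The edge of the action graph of `ρ` traversed by the letter `a` from the vertex `s`,
represented by its label and its initial vertex. -/
def edge (ρ : FreeGroup α →* Equiv.Perm S) (a : α × Bool) (s : S) : α × S :=
  (a.1, if a.2 then s else (ρ (of a.1))⁻¹ s)

/-- The sign of an exponent. -/
def expSign (K : Type*) [Ring K] (b : Bool) : K := if b then 1 else -1

theorem cocycle_letter (K : Type*) [Ring K] (ρ : FreeGroup α →* Equiv.Perm S) (ψ : α × S → K)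
    (a : α × Bool) (s : S) : cocycle ρ ψ (mk [a]) s = expSign K a.2 * ψ (edge ρ a s) := by
  obtain ⟨x, b⟩ := a
  cases b
  · simp [mk_singleton_false, cocycle_inv, cocycle_of, edge, expSign]
  · simp [mk_singleton_true, cocycle_of, edge, expSign]

theorem cocycle_partialProd (K : Type*) [Ring K] (ρ : FreeGroup α →* Equiv.Perm S)
    (ψ : α × S → K) (y : ℕ → α × Bool) (s : S) (n : ℕ) :
    cocycle ρ ψ (partialProd y n) s =
      ∑ k ∈ Finset.range n, expSign K (y k).2 * ψ (edge ρ (y k) (ρ (partialProd y k) s)) := by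
  induction n with
  | zero => simp [partialProd, cocycle_one]
  | succ n ih => rw [partialProd, cocycle_mul, ih, Finset.sum_range_succ, cocycle_letter]

/-- The path from `s` spelled by the word `y` is a closed path of length `M` without
self-intersections. -/
structure IsSimpleLine (ρ : FreeGroup α →* Equiv.Perm S) (y : ℕ → α × Bool) (s : S) (M : ℕ) :
    Prop where
  pos : 0 < M
  periodic : ∀ n, y (n + M) = y n
  reduced : ∀ n, y (n + 1) ≠ ((y n).1, !(y n).2)
  closed : ρ (partialProd y M) s = s
  simple : ∀ m n, ρ (partialProd y m) s = ρ (partialProd y n) s → m ≡ n [MOD M]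

namespace IsSimpleLine

variable {ρ : FreeGroup α →* Equiv.Perm S} {y y' : ℕ → α × Bool} {s s' : S} {M M' : ℕ}

theorem vertex_add (h : IsSimpleLine ρ y s M) (n : ℕ) :
    ρ (partialProd y (n + M)) s = ρ (partialProd y n) s := by
  rw [partialProd_add, _root_.map_mul, Equiv.Perm.mul_apply, h.closed]
  simp only [h.periodic]

theorem letter_congr (h : IsSimpleLine ρ y s M) {m n : ℕ} (hmn : m ≡ n [MOD M]) : y m = y n := by
  have hp : Function.Periodic y M := h.periodic
  rw [← hp.map_mod_nat m, ← hp.map_mod_nat n, hmn]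

theorem vertex_congr (h : IsSimpleLine ρ y s M) {m n : ℕ} (hmn : m ≡ n [MOD M]) :
    ρ (partialProd y m) s = ρ (partialProd y n) s := by
  have hp : Function.Periodic (fun n => ρ (partialProd y n) s) M := h.vertex_add
  exact (hp.map_mod_nat m).symm.trans
    ((congrArg (fun n => ρ (partialProd y n) s) hmn).trans (hp.map_mod_nat n))

theorem modEq_of_edge_eq (h : IsSimpleLine ρ y s M) {m n : ℕ}
    (he : edge ρ (y m) (ρ (partialProd y m) s) = edge ρ (y n) (ρ (partialProd y n) s)) :
    m ≡ n [MOD M] := by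
  have key : ∀ m n, (y m).1 = (y n).1 → (y m).2 = true → (y n).2 = false →
      ρ (partialProd y m) s = (ρ (of (y n).1))⁻¹ (ρ (partialProd y n) s) → False := by
    intro m n h1 hm hn hv
    have hyn : y n = ((y n).1, false) := Prod.ext rfl hn
    have h2 : ρ (partialProd y (n + 1)) s = ρ (partialProd y m) s := by
      rw [partialProd, hyn, mk_singleton_false, hv, _root_.map_mul, _root_.map_inv]
      rfl
    refine h.reduced n ((h.letter_congr (h.simple _ _ h2)).trans (Prod.ext h1 ?_))
    simp [hm, hn]
  simp only [edge, Prod.mk.injEq] at he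
  obtain ⟨h1, h2⟩ := he
  rcases hm : (y m).2 with _ | _ <;> rcases hn : (y n).2 with _ | _ <;>
    simp only [hm, hn, if_true, if_false, Bool.false_eq_true] at h2
  · rw [h1] at h2
    exact h.simple _ _ (Equiv.injective _ h2)
  · exact (key n m h1.symm hn hm h2.symm).elim
  · exact (key m n h1 hm hn h2).elim
  · exact h.simple _ _ h2

theorem cocycle_single_edge [DecidableEq (α × S)] (K : Type*) [Ring K] (h : IsSimpleLine ρ y s M)
    (n : ℕ) :
    cocycle ρ (Pi.single (edge ρ (y n) (ρ (partialProd y n) s)) (1 : K)) (partialProd y M) s =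
      expSign K (y n).2 := by
  have hmod : n % M ≡ n [MOD M] := Nat.mod_modEq n M
  rw [cocycle_partialProd, Finset.sum_eq_single (n % M)]
  · rw [h.letter_congr hmod, h.vertex_congr hmod]
    simp
  · intro k hk hne
    rw [Pi.single_eq_of_ne, mul_zero]
    intro he
    have := h.modEq_of_edge_eq he
    rw [Nat.ModEq, Nat.mod_eq_of_lt (Finset.mem_range.1 hk)] at this
    exact hne this
  · intro hn
    exact (hn (Finset.mem_range.2 (Nat.mod_lt n h.pos))).elim

theorem cocycle_single_of_ne [DecidableEq (α × S)] (K : Type*) [Ring K] (M : ℕ) {e : α × S}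
    (he : ∀ n < M, edge ρ (y n) (ρ (partialProd y n) s) ≠ e) :
    cocycle ρ (Pi.single e (1 : K)) (partialProd y M) s = 0 := by
  rw [cocycle_partialProd]
  exact Finset.sum_eq_zero fun k hk => by
    rw [Pi.single_eq_of_ne (he k (Finset.mem_range.1 hk)), mul_zero]

theorem expSign_ne_zero (K : Type*) [Ring K] [Nontrivial K] (b : Bool) : expSign K b ≠ 0 := by
  cases b <;> simp [expSign]

theorem expSign_injective {K : Type*} [Ring K] (hK : (1 : K) ≠ -1) :
    Function.Injective (expSign K) := by
  intro a b
  cases a <;> cases b <;> simp [expSign, hK, hK.symm]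

/-- Two simple closed lines crossing every edge the same number of times agree up to a shift. -/
theorem exists_shift [DecidableEq (α × S)] {K : Type*} [Ring K] [Nontrivial K] (hK : (1 : K) ≠ -1)
    (h : IsSimpleLine ρ y s M) (h' : IsSimpleLine ρ y' s' M')
    (heq : ∀ e, cocycle ρ (Pi.single e (1 : K)) (partialProd y' M') s' =
      cocycle ρ (Pi.single e (1 : K)) (partialProd y M) s) :
    ∃ m, ∀ n, y' n = y (n + m) := by
  have key : ∀ n, ∃ m, y' n = y m ∧ ρ (partialProd y' n) s' = ρ (partialProd y m) s := by
    intro n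
    have h1 := heq (edge ρ (y' n) (ρ (partialProd y' n) s'))
    rw [h'.cocycle_single_edge K n] at h1
    by_cases hm : ∃ m, edge ρ (y m) (ρ (partialProd y m) s) =
        edge ρ (y' n) (ρ (partialProd y' n) s')
    · obtain ⟨m, hm⟩ := hm
      rw [← hm, h.cocycle_single_edge K m] at h1
      have hsgn := expSign_injective hK h1
      have hy : y' n = y m := Prod.ext (congrArg Prod.fst hm).symm hsgn
      refine ⟨m, hy, ?_⟩
      have hv := (congrArg Prod.snd hm).symm
      simp only [edge, hy] at hv
      split_ifs at hv
      · exact hv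
      · exact Equiv.injective _ hv
    · push Not at hm
      rw [cocycle_single_of_ne K M fun m _ => hm m] at h1
      exact (expSign_ne_zero K _ h1).elim
  obtain ⟨m, -, hm⟩ := key 0
  refine ⟨m, ?_⟩
  have hind : ∀ n, ρ (partialProd y' n) s' = ρ (partialProd y (n + m)) s ∧ y' n = y (n + m) := by
    intro n
    have hstep : ∀ n, ρ (partialProd y' n) s' = ρ (partialProd y (n + m)) s →
        y' n = y (n + m) := by
      intro n hn
      obtain ⟨k, hk, hv⟩ := key n
      rw [hk]
      exact h.letter_congr (h.simple _ _ (hv.symm.trans hn))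
    induction n with
    | zero =>
      have : ρ (partialProd y' 0) s' = ρ (partialProd y (0 + m)) s := by rw [hm, zero_add]
      exact ⟨this, hstep 0 this⟩
    | succ n ih =>
      have : ρ (partialProd y' (n + 1)) s' = ρ (partialProd y (n + 1 + m)) s := by
        rw [Nat.add_right_comm, partialProd, partialProd, _root_.map_mul, _root_.map_mul,
          Equiv.Perm.mul_apply, Equiv.Perm.mul_apply, ih.1, ih.2]
      exact ⟨this, hstep _ this⟩
  exact fun n => (hind n).2

/-- If two simple closed lines do not follow each other in either direction, then some cocycle
vanishes on the first one but not on the second one. -/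
theorem exists_cocycle_ne_zero {K : Type*} [Field K] (hK : (1 : K) ≠ -1)
    {z : ℕ → α × Bool} (h : IsSimpleLine ρ y s M) (hz : IsSimpleLine ρ z s M)
    (hyz : partialProd z M = (partialProd y M)⁻¹) (h' : IsSimpleLine ρ y' s' M')
    (hy' : ∀ m, ∃ n, y' n ≠ y (n + m)) (hz' : ∀ m, ∃ n, y' n ≠ z (n + m)) :
    ∃ ψ : α × S → K, cocycle ρ ψ (partialProd y M) s = 0 ∧
      cocycle ρ ψ (partialProd y' M') s' ≠ 0 := by
  classical
  by_contra! hcon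
  let σ := cocycleLinear ρ K (partialProd y M) s
  let τ := cocycleLinear ρ K (partialProd y' M') s'
  let δ : α × S → α × S → K := fun e => Pi.single e 1
  have hprop : ∀ e e', σ (δ e') * τ (δ e) = σ (δ e) * τ (δ e') := by
    intro e e'
    have h1 := hcon (σ (δ e') • δ e - σ (δ e) • δ e')
    rw [← cocycleLinear_apply, ← cocycleLinear_apply] at h1
    have h2 : τ (σ (δ e') • δ e - σ (δ e) • δ e') = 0 := h1 (by
      change σ _ = 0
      rw [map_sub, map_smul, map_smul, smul_eq_mul, smul_eq_mul, mul_comm, sub_self])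
    rw [map_sub, map_smul, map_smul, smul_eq_mul, smul_eq_mul] at h2
    exact sub_eq_zero.1 h2
  have hsq : ∀ b, expSign K b * expSign K b = 1 := by intro b; cases b <;> simp [expSign]
  set e₀ := edge ρ (y' 0) (ρ (partialProd y' 0) s') with he₀
  have hτ₀ : τ (δ e₀) = expSign K (y' 0).2 := h'.cocycle_single_edge K 0
  have hσ₀ : ∃ m, σ (δ e₀) = expSign K (y m).2 := by
    by_cases hm : ∃ m, edge ρ (y m) (ρ (partialProd y m) s) = e₀
    · obtain ⟨m, hm⟩ := hm
      exact ⟨m, hm ▸ h.cocycle_single_edge K m⟩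
    · push Not at hm
      have h0 : σ (δ e₀) = 0 := cocycle_single_of_ne K M fun m _ => hm m
      have h1 := hprop (edge ρ (y 0) (ρ (partialProd y 0) s)) e₀
      have h2 : σ (δ (edge ρ (y 0) (ρ (partialProd y 0) s))) = expSign K (y 0).2 :=
        h.cocycle_single_edge K 0
      rw [h0, h2, hτ₀, zero_mul] at h1
      exact (mul_ne_zero (expSign_ne_zero K _) (expSign_ne_zero K _) h1.symm).elim
  obtain ⟨m, hm⟩ := hσ₀
  have hττ : ∀ e, τ (δ e) = expSign K (y m).2 * expSign K (y' 0).2 * σ (δ e) := by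
    intro e
    have h1 := hprop e e₀
    rw [hm, hτ₀] at h1
    calc τ (δ e) = expSign K (y m).2 * expSign K (y m).2 * τ (δ e) := by rw [hsq, one_mul]
      _ = _ := by rw [mul_assoc, h1]; ring
  have hc : expSign K (y m).2 * expSign K (y' 0).2 = 1 ∨
      expSign K (y m).2 * expSign K (y' 0).2 = -1 := by
    cases (y m).2 <;> cases (y' 0).2 <;> simp [expSign]
  rcases hc with hc | hc
  · obtain ⟨m, hm⟩ := exists_shift hK h h' fun e => by simpa [hc, σ, τ, δ] using hττ e
    obtain ⟨n, hn⟩ := hy' m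
    exact hn (hm n)
  · obtain ⟨m, hm⟩ := exists_shift hK hz h' fun e => by
      have hfix : (ρ (partialProd y M))⁻¹ s = s := by
        rw [Equiv.Perm.inv_eq_iff_eq, h.closed]
      rw [hyz, cocycle_inv, hfix]
      simpa [hc, σ, τ, δ] using hττ e
    obtain ⟨n, hn⟩ := hz' m
    exact hn (hm n)

/-- A cocycle as in `exists_cocycle_ne_zero` can be chosen uniformly in the base point of the
second line if the field is large enough. -/
theorem exists_cocycle_forall_ne_zero [Finite S] {q : ℕ} [Fact q.Prime] (hq : 2 < q)
    (hS : Nat.card S < q) {z : ℕ → α × Bool} (h : IsSimpleLine ρ y s M)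
    (hz : IsSimpleLine ρ z s M) (hyz : partialProd z M = (partialProd y M)⁻¹)
    (h' : ∀ t, IsSimpleLine ρ y' t M')
    (hy' : ∀ m, ∃ n, y' n ≠ y (n + m)) (hz' : ∀ m, ∃ n, y' n ≠ z (n + m)) :
    ∃ ψ : α × S → ZMod q, cocycle ρ ψ (partialProd y M) s = 0 ∧
      ∀ t, cocycle ρ ψ (partialProd y' M') t ≠ 0 := by
  have : Fintype S := Fintype.ofFinite S
  have : Fact (2 < q) := ⟨hq⟩
  have hK : (1 : ZMod q) ≠ -1 := ZMod.neg_one_ne_one.symm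
  let W := LinearMap.ker (cocycleLinear ρ (ZMod q) (partialProd y M) s)
  let p : S → Submodule (ZMod q) W := fun t =>
    LinearMap.ker ((cocycleLinear ρ (ZMod q) (partialProd y' M') t).domRestrict W)
  have hp : ∀ t, p t ≠ ⊤ := by
    intro t ht
    obtain ⟨ψ, h1, h2⟩ := exists_cocycle_ne_zero hK h hz hyz (h' t) hy' hz'
    have hmem : (⟨ψ, h1⟩ : W) ∈ p t := ht ▸ Submodule.mem_top
    exact h2 hmem
  have hlt := Submodule.iUnion_ssubset_of_forall_ne_top_of_card_lt Finset.univ p hp (by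
    rw [ENat.card_eq_coe_natCard, Nat.card_zmod, Finset.card_univ, ← Nat.card_eq_fintype_card]
    exact_mod_cast hS)
  obtain ⟨ψ, -, hψ⟩ := Set.exists_of_ssubset hlt
  refine ⟨ψ.1, ψ.2, fun t ht => hψ ?_⟩
  simp only [Finset.mem_univ, Set.iUnion_true, Set.mem_iUnion]
  exact ⟨t, ht⟩

theorem edge_skewHom {A : Type*} [AddCommGroup A] (ρ : FreeGroup α →* Equiv.Perm S)
    (ψ : α × S → A) (a : α × Bool) (t : S × A) :
    ((edge (skewHom ρ ψ) a t).1, (edge (skewHom ρ ψ) a t).2.1) = edge ρ a t.1 := by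
  obtain ⟨x, b⟩ := a
  cases b
  · simp only [edge, Bool.false_eq_true, if_false, ← _root_.map_inv]
    rw [← Prod.mk.eta (p := t), skewHom_apply]
  · simp [edge]

theorem skewHom_line {A : Type*} [AddCommGroup A] {ψ : α × S → A} (h : IsSimpleLine ρ y s M)
    (h0 : cocycle ρ ψ (partialProd y M) s = 0) : IsSimpleLine (skewHom ρ ψ) y (s, 0) M where
  pos := h.pos
  periodic := h.periodic
  reduced := h.reduced
  closed := by rw [skewHom_apply, h0, h.closed, add_zero]
  simple m n hmn := by
    rw [skewHom_apply, skewHom_apply] at hmn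
    exact h.simple m n (congrArg Prod.fst hmn)

/-- If `ψ` vanishes on a simple closed line but on no cycle of `g`, then over the skew product
there is a cocycle which vanishes on the cycles of all elements commuting with `g` but not on
the lift of the line. -/
theorem exists_cocycle_skewHom {q : ℕ} [Fact q.Prime] {ψ : α × S → ZMod q}
    (h : IsSimpleLine ρ y s M) (h0 : cocycle ρ ψ (partialProd y M) s = 0) {g : FreeGroup α}
    (hg : ∀ t, ρ g t = t) (hψ : ∀ t, cocycle ρ ψ g t ≠ 0) (K : Type*) [CommRing K]
    [Nontrivial K] :
    ∃ ψ' : α × (S × ZMod q) → K,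
      (∀ f, Commute f g → ∀ t, skewHom ρ ψ f t = t → cocycle (skewHom ρ ψ) ψ' f t = 0) ∧
      cocycle (skewHom ρ ψ) ψ' (partialProd y M) (s, 0) ≠ 0 := by
  classical
  have hline := h.skewHom_line h0
  let e := edge (skewHom ρ ψ) (y 0) (s, 0)
  let δ : α × (S × ZMod q) → K := Pi.single e 1
  let T : S × ZMod q → S × ZMod q := fun t => (t.1, t.2 - 1)
  have hT : ∀ x t, skewHom ρ ψ (of x) (T t) = T (skewHom ρ ψ (of x) t) := by
    rintro x ⟨t, a⟩
    simp only [T, skewHom_of_apply, Prod.mk.injEq, true_and]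
    ring
  have hδ : ∀ f t, cocycle (skewHom ρ ψ) (δ - fun e => δ (e.1, T e.2)) f t =
      cocycle (skewHom ρ ψ) δ f t - cocycle (skewHom ρ ψ) δ f (T t) := by
    intro f t
    rw [← cocycle_comp δ hT, ← cocycleLinear_apply, map_sub]
    rfl
  refine ⟨δ - fun e => δ (e.1, T e.2), fun f hf t ht => ?_, ?_⟩
  · obtain ⟨t, a⟩ := t
    have hpow : ∀ j : ℕ, skewHom ρ ψ (g ^ j) (t, a) = (t, a + j * cocycle ρ ψ g t) := by
      intro j
      have hgj : ρ (g ^ j) t = t := by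
        rw [map_pow]
        exact Equiv.Perm.pow_apply_eq_self_of_apply_eq_self (hg t) j
      rw [skewHom_apply, cocycle_pow ψ (hg t), nsmul_eq_mul, hgj]
    have hTt : T (t, a) = skewHom ρ ψ (g ^ (-(cocycle ρ ψ g t)⁻¹).val) (t, a) := by
      rw [hpow, ZMod.natCast_zmod_val, neg_mul, inv_mul_cancel₀ (hψ t)]
      exact Prod.ext rfl (sub_eq_add_neg a 1)
    rw [hδ, hTt, cocycle_conj_of_fixed δ (hf.pow_right _) ht, sub_self]
  · have h1 : cocycle (skewHom ρ ψ) δ (partialProd y M) (s, 0) = expSign K (y 0).2 :=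
      hline.cocycle_single_edge K 0
    have h2 : cocycle (skewHom ρ ψ) δ (partialProd y M) (T (s, 0)) = 0 := by
      refine cocycle_single_of_ne K M fun n hn he => ?_
      have he' := congrArg (fun e : α × (S × ZMod q) => (e.1, e.2.1)) he
      have hfst : (skewHom ρ ψ (partialProd y n) (T (s, 0))).1 = ρ (partialProd y n) s := by
        rw [skewHom_apply]
      simp only [e, edge_skewHom, hfst] at he'
      have h3 : n ≡ 0 [MOD M] := h.modEq_of_edge_eq (by simpa [partialProd] using he')
      have h4 : n = 0 := by rwa [Nat.ModEq, Nat.mod_eq_of_lt hn, Nat.zero_mod] at h3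
      subst h4
      have h5 := congrArg Prod.snd he
      simp only [e, edge] at h5
      have h6 : T (s, 0) = (s, 0) := by
        split_ifs at h5
        · simpa [partialProd] using h5
        · simpa [partialProd] using h5
      simp [T] at h6
    rw [hδ, h2, sub_zero, h1]
    exact expSign_ne_zero K _

end IsSimpleLine

end Line

/-- A periodic word spells simple closed lines in the Cayley graph of every finite quotient in
which the short differences of its prefixes avoid the cyclic subgroup generated by its period. -/
theorem IsPeriodicWord.isSimpleLine {y : ℕ → α × Bool} {l : ℕ} (hy : IsPeriodicWord y l)
    {H : Type*} [Group H] [Finite H] (φ : FreeGroup α →* H)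
    (hφ : ∀ i j, i < l → j < l → i ≠ j →
      φ ((partialProd y j)⁻¹ * partialProd y i) ∉ Subgroup.zpowers (φ (partialProd y l)))
    (s : H) :
    IsSimpleLine ((MulAction.toPermHom H H).comp φ) y s (l * orderOf (φ (partialProd y l))) where
  pos := Nat.mul_pos hy.pos (orderOf_pos _)
  periodic n := hy.periodic_mul n _
  reduced := hy.reduced
  closed := by simp [hy.partialProd_mul, pow_orderOf_eq_one]
  simple m n hmn := by
    have h1 : φ (partialProd y m) = φ (partialProd y n) := by simpa using hmn
    have hm := Nat.mod_add_div m l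
    have hn := Nat.mod_add_div n l
    rw [← hm, ← hn, hy.partialProd_add_mul, hy.partialProd_add_mul] at h1
    simp only [_root_.map_mul, map_pow] at h1
    have hmod : m % l = n % l := by
      by_contra hne
      refine hφ _ _ (Nat.mod_lt m hy.pos) (Nat.mod_lt n hy.pos) hne ?_
      have h2 : φ ((partialProd y (n % l))⁻¹ * partialProd y (m % l)) =
          φ (partialProd y l) ^ (n / l) * (φ (partialProd y l) ^ (m / l))⁻¹ := by
        rw [_root_.map_mul, _root_.map_inv, eq_mul_inv_iff_mul_eq, mul_assoc, h1,
          inv_mul_cancel_left]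
      rw [h2]
      exact mul_mem (pow_mem (Subgroup.mem_zpowers _) _)
        (inv_mem (pow_mem (Subgroup.mem_zpowers _) _))
    rw [hmod] at h1
    have h3 := pow_eq_pow_iff_modEq.1 (mul_left_cancel h1)
    rw [← hm, ← hn, hmod]
    exact (h3.mul_left' l).add_left _

theorem orderOf_map_of_isConj {G H : Type*} [Group G] [Group H] (φ : G →* H) {a b : G}
    (h : IsConj a b) : orderOf (φ a) = orderOf (φ b) := by
  obtain ⟨c, hc⟩ := h
  exact (hc.map φ).orderOf_eq _

/-- For each prime `p`, elements of a free group without conjugate nontrivial powers are separated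
by the `p`-parts of the orders of their images in a finite group. The integer `m` controlling the
part of the orders prime to `p` does not depend on `p`. -/
theorem exists_prime_dvd_orderOf {u v : FreeGroup α} (hu : u ≠ 1) (hv : v ≠ 1)
    (huv : ∀ k l : ℤ, k ≠ 0 → l ≠ 0 → ¬ IsConj (u ^ k) (v ^ l)) :
    ∃ m : ℕ, 0 < m ∧ ∀ p : ℕ, p.Prime →
      ∃ (H : Type u) (_ : Group H) (_ : Finite H) (φ : FreeGroup α →* H),
        (∀ f, orderOf (φ f) ∣ m * p) ∧ p ∣ orderOf (φ u) ∧ orderOf (φ v) ∣ m := by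
  obtain ⟨y, z, l, hy, hz, huy, hyz⟩ := exists_isConj_partialProd hu
  obtain ⟨y', -, l', hy', -, hvy', -⟩ := exists_isConj_partialProd hv
  let D : (ℕ → α × Bool) → ℕ → Set (FreeGroup α × FreeGroup α) := fun y l =>
    (fun ij : ℕ × ℕ => (partialProd y l, (partialProd y ij.2)⁻¹ * partialProd y ij.1)) ''
      {ij ∈ Set.Iio l ×ˢ Set.Iio l | ij.1 ≠ ij.2}
  have hDfin : ∀ y l, (D y l).Finite := fun y l =>
    ((((Set.finite_Iio l).prod (Set.finite_Iio l))).subset (Set.sep_subset _ _)).image _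
  have hD : ∀ y l, IsPeriodicWord y l → ∀ a ∈ D y l, a.2 ∉ Subgroup.zpowers a.1 := by
    rintro y l h _ ⟨⟨i, j⟩, ⟨⟨hi, hj⟩, hij⟩, rfl⟩
    exact h.notMem_zpowers hi hj hij
  obtain ⟨G, hG, hGfin, φ, hφ⟩ := exists_finite_forall_notMem_zpowers (D y l ∪ D z l ∪ D y' l')
    (((hDfin y l).union (hDfin z l)).union (hDfin y' l')) (by
      rintro a ((ha | ha) | ha)
      · exact hD y l hy a ha
      · exact hD z l hz a ha
      · exact hD y' l' hy' a ha)
  have hsep : ∀ y₀ l₀, D y₀ l₀ ⊆ D y l ∪ D z l ∪ D y' l' → ∀ i j, i < l₀ → j < l₀ → i ≠ j →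
      φ ((partialProd y₀ j)⁻¹ * partialProd y₀ i) ∉ Subgroup.zpowers (φ (partialProd y₀ l₀)) :=
    fun y₀ l₀ hsub i j hi hj hij => hφ _ (hsub ⟨(i, j), ⟨⟨hi, hj⟩, hij⟩, rfl⟩)
  set ρ := (MulAction.toPermHom G G).comp φ
  set M := l * orderOf (φ (partialProd y l)) with hM
  set M' := l' * orderOf (φ (partialProd y' l')) with hM'
  have hyl : IsSimpleLine ρ y 1 M := hy.isSimpleLine φ
    (hsep y l (Set.subset_union_left.trans Set.subset_union_left)) 1
  have hzl : IsSimpleLine ρ z 1 M := by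
    have := hz.isSimpleLine φ
      (hsep z l (Set.subset_union_right.trans Set.subset_union_left)) 1
    rwa [hyz, _root_.map_inv, orderOf_inv] at this
  have hyl' : ∀ t, IsSimpleLine ρ y' t M' := hy'.isSimpleLine φ (hsep y' l' Set.subset_union_right)
  have hyzM : partialProd z M = (partialProd y M)⁻¹ := by
    rw [hM, hy.partialProd_mul, hz.partialProd_mul, hyz, inv_pow]
  have hncy : ∀ k l₀ : ℤ, k ≠ 0 → l₀ ≠ 0 →
      ¬ IsConj (partialProd y l ^ k) (partialProd y' l' ^ l₀) := by
    intro k l₀ hk hl hcon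
    have conj_zpow : ∀ {a b : FreeGroup α} (k : ℤ), IsConj a b → IsConj (a ^ k) (b ^ k) := by
      intro a b k hab
      obtain ⟨c, rfl⟩ := isConj_iff.1 hab
      exact isConj_iff.2 ⟨c, conj_zpow.symm⟩
    exact huv k l₀ hk hl (((conj_zpow k huy).trans hcon).trans (conj_zpow l₀ hvy').symm)
  have hl0 : (l : ℤ) ≠ 0 := by exact_mod_cast hy.pos.ne'
  have hl0' : (l' : ℤ) ≠ 0 := by exact_mod_cast hy'.pos.ne'
  have hshift : ∀ m, ∃ n, y' n ≠ y (n + m) := by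
    intro m
    by_contra! hcon
    refine hncy l' l hl0' hl0 ?_
    simpa using hy.isConj_of_shift hy' m hcon
  have hshift' : ∀ m, ∃ n, y' n ≠ z (n + m) := by
    intro m
    by_contra! hcon
    refine hncy (-l') l (neg_ne_zero.2 hl0') hl0 ?_
    simpa [hyz] using hz.isConj_of_shift hy' m hcon
  obtain ⟨q, hq, hqp⟩ := Nat.exists_infinite_primes (max 3 (Nat.card G + 1))
  have : Fact q.Prime := ⟨hqp⟩
  obtain ⟨ψ, hψ0, hψ⟩ := IsSimpleLine.exists_cocycle_forall_ne_zero (q := q)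
    (lt_of_lt_of_le (le_max_left 3 _) hq) (lt_of_lt_of_le (le_max_right 3 _) hq)
    hyl hzl hyzM hyl' hshift hshift'
  have hfin : Finite (Equiv.Perm (G × ZMod q)) := inferInstance
  set m := Nat.card (Equiv.Perm (G × ZMod q)) with hm
  have hpow : ∀ f t, skewHom ρ ψ (f ^ m) t = t := by
    intro f t
    rw [map_pow, hm, pow_card_eq_one']
    rfl
  refine ⟨m, Nat.card_pos, fun p hp => ?_⟩
  have : Fact p.Prime := ⟨hp⟩
  obtain ⟨ψ', hψ'0, hψ'⟩ := hyl.exists_cocycle_skewHom hψ0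
    (fun t => (hyl' t).closed) hψ (ZMod p)
  refine ⟨Equiv.Perm ((G × ZMod q) × ZMod p), inferInstance, inferInstance,
    skewHom (skewHom ρ ψ) ψ', fun f => ?_, ?_, ?_⟩
  · refine orderOf_dvd_of_pow_eq_one (Equiv.ext fun t => ?_)
    rw [← map_pow, pow_mul, ← Prod.mk.eta (p := t), skewHom_apply, cocycle_pow _ (hpow f _),
      map_pow, Equiv.Perm.pow_apply_eq_self_of_apply_eq_self (hpow f _)]
    simp
  · rw [orderOf_map_of_isConj _ huy]
    have hline := hyl.skewHom_line hψ0
    have h1 : (skewHom (skewHom ρ ψ) ψ'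
        (partialProd y M ^ orderOf (skewHom (skewHom ρ ψ) ψ' (partialProd y l))))
          ((1, 0), 0) = ((1, 0), 0) := by
      rw [hM, hy.partialProd_mul, ← pow_mul, mul_comm, pow_mul, map_pow, map_pow,
        pow_orderOf_eq_one, one_pow]
      rfl
    rw [skewHom_apply, cocycle_pow _ hline.closed, zero_add, nsmul_eq_mul] at h1
    have h2 := congrArg Prod.snd h1
    exact (ZMod.natCast_eq_zero_iff _ _).1 ((mul_eq_zero.1 h2).resolve_right hψ')
  · rw [orderOf_map_of_isConj _ hvy']
    refine orderOf_dvd_of_pow_eq_one (Equiv.ext fun t => ?_)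
    rw [← map_pow, ← Prod.mk.eta (p := t), skewHom_apply, hψ'0 _ ?_ _ (hpow _ _), hpow, add_zero]
    · rfl
    · rw [hM', hy'.partialProd_mul]
      exact (Commute.refl _).pow_pow _ _

/-- The orders of finitely many nontrivial elements of a free group in a finite quotient can be
made divisible by any given positive integer. -/
theorem exists_finite_forall_dvd_orderOf (s : Set (FreeGroup α)) (hs : s.Finite) {K : ℕ}
    (hK : 0 < K) : ∃ (H : Type u) (_ : Group H) (_ : Finite H) (φ : FreeGroup α →* H),
      ∀ a ∈ s, a ≠ 1 → K ∣ orderOf (φ a) := by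
  obtain ⟨H, hH, hfin, φ, hφ⟩ := exists_finite_forall_notMem_zpowers
    ((fun p : FreeGroup α × ℕ => (p.1 ^ K, p.1 ^ p.2)) '' ((s \ {1}) ×ˢ Set.Ioo 0 K))
    ((hs.sdiff.prod (Set.finite_Ioo 0 K)).image _) (by
      rintro _ ⟨⟨a, k⟩, ⟨⟨-, ha⟩, hk0, hkK⟩, rfl⟩ ⟨j, hj⟩
      have h1 : a ^ ((K : ℤ) * j - k) = 1 := by
        rw [zpow_sub, zpow_mul, zpow_natCast, zpow_natCast, mul_inv_eq_one]
        exact hj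
      have h2 : (K : ℤ) * j - k = 0 := by
        by_contra hne
        exact ha ((zpow_left_inj hne).1 (h1.trans (one_zpow _).symm))
      have h3 : K ∣ k := Int.natCast_dvd_natCast.1 ⟨j, (sub_eq_zero.1 h2).symm⟩
      exact (Nat.le_of_dvd hk0 h3).not_gt hkK)
  refine ⟨H, hH, hfin, φ, fun a ha ha1 => ?_⟩
  rw [← Nat.gcd_eq_left_iff_dvd]
  refine (Nat.le_of_dvd hK (Nat.gcd_dvd_left _ _)).antisymm (not_lt.1 fun hlt => ?_)
  refine hφ _ ⟨(a, K.gcd (orderOf (φ a))), ⟨⟨ha, ha1⟩, Nat.gcd_pos_of_pos_left _ hK, hlt⟩, rfl⟩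
    ⟨K.gcdA (orderOf (φ a)), ?_⟩
  simp only [map_pow]
  rw [← zpow_natCast _ (K.gcd _), Nat.gcd_eq_gcd_ab, zpow_add, zpow_mul, zpow_mul, zpow_natCast,
    zpow_natCast, pow_orderOf_eq_one, one_zpow, mul_one]

theorem orderOf_zpow_mul_natAbs {G : Type*} [Group G] {x : G} {k : ℤ}
    (hk : k.natAbs ∣ orderOf x) : orderOf (x ^ k) * k.natAbs = orderOf x := by
  have h : orderOf (x ^ k) = orderOf (x ^ k.natAbs) := by
    obtain ⟨n, rfl | rfl⟩ := k.eq_nat_or_neg <;> simp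
  rcases eq_or_ne k 0 with rfl | hk0
  · simpa using (Nat.eq_zero_of_zero_dvd hk).symm
  rw [h, orderOf_pow' x (Int.natAbs_ne_zero.2 hk0), Nat.gcd_eq_right hk, Nat.div_mul_cancel hk]

/-- If two elements of a free group with conjugate powers have the same order divisible by the
exponents in a finite quotient, then they are conjugate up to inversion. -/
theorem isConj_or_isConj_inv_of_orderOf_eq {a b : FreeGroup α} {k l : ℤ} (hk : k ≠ 0)
    (hkl : IsConj (a ^ k) (b ^ l)) {H : Type*} [Group H] [Finite H] (φ : FreeGroup α →* H)
    (hka : k.natAbs ∣ orderOf (φ a)) (hlb : l.natAbs ∣ orderOf (φ b))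
    (hab : orderOf (φ a) = orderOf (φ b)) : IsConj a b ∨ IsConj a b⁻¹ := by
  have h1 := orderOf_zpow_mul_natAbs hka
  have h2 := orderOf_zpow_mul_natAbs hlb
  have h3 := orderOf_map_of_isConj φ hkl
  rw [map_zpow, map_zpow] at h3
  rw [hab, ← h2, h3] at h1
  have h4 : k.natAbs = l.natAbs := Nat.eq_of_mul_eq_mul_left (orderOf_pos _) h1
  have key : ∀ b' : FreeGroup α, IsConj (a ^ k) (b' ^ k) → IsConj a b' := by
    intro b' h
    obtain ⟨c, hc⟩ := isConj_iff.1 h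
    rw [← conj_zpow] at hc
    exact isConj_iff.2 ⟨c, (zpow_left_inj hk).1 hc⟩
  rcases Int.natAbs_eq_natAbs_iff.1 h4 with rfl | rfl
  · exact Or.inl (key b hkl)
  · exact Or.inr (key b⁻¹ (by simpa using hkl))

/-- Elements of a free group, no two of which are conjugate up to inversion, acquire different
orders in some finite group. -/
theorem exists_finite_orderOf_ne {ι : Type} [Finite ι] (w : ι → FreeGroup α)
    (hw : ∀ i j, i ≠ j → ¬ IsConj (w i) (w j) ∧ ¬ IsConj (w i) (w j)⁻¹) :
    ∃ (H : Type u) (_ : Group H) (_ : Finite H) (φ : FreeGroup α →* H),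
      ∀ i j, i ≠ j → orderOf (φ (w i)) ≠ orderOf (φ (w j)) := by
  classical
  have := Fintype.ofFinite ι
  have hexp : ∀ c : ι × ι, ∃ k l : ℤ, k ≠ 0 ∧ l ≠ 0 ∧
      ((∃ k l : ℤ, k ≠ 0 ∧ l ≠ 0 ∧ IsConj (w c.1 ^ k) (w c.2 ^ l)) →
        IsConj (w c.1 ^ k) (w c.2 ^ l)) := by
    intro c
    by_cases h : ∃ k l : ℤ, k ≠ 0 ∧ l ≠ 0 ∧ IsConj (w c.1 ^ k) (w c.2 ^ l)
    · obtain ⟨k, l, hk, hl, hkl⟩ := h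
      exact ⟨k, l, hk, hl, fun _ => hkl⟩
    · exact ⟨1, 1, one_ne_zero, one_ne_zero, fun h' => absurd h' h⟩
  choose k l hk hl hkl using hexp
  set K := 2 * ∏ c, (k c).natAbs * (l c).natAbs with hKdef
  have hKpos : 0 < K := Nat.mul_pos two_pos (Finset.prod_pos fun c _ =>
    Nat.mul_pos (Int.natAbs_pos.2 (hk c)) (Int.natAbs_pos.2 (hl c)))
  have hdvdK : ∀ c, (k c).natAbs * (l c).natAbs ∣ K := fun c =>
    (Finset.dvd_prod_of_mem (fun c => (k c).natAbs * (l c).natAbs) (Finset.mem_univ c)).mul_left 2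
  obtain ⟨H₀, hH₀, hfin₀, φ₀, hφ₀⟩ :=
    exists_finite_forall_dvd_orderOf (Set.range w) (Set.finite_range w) hKpos
  have hpair : ∀ c : ι × ι, ∃ m : ℕ, 0 < m ∧ ∀ p : ℕ, p.Prime →
      ∃ (H : Type u) (_ : Group H) (_ : Finite H) (φ : FreeGroup α →* H),
        (∀ f, orderOf (φ f) ∣ m * p) ∧ (w c.1 ≠ 1 → w c.2 ≠ 1 →
          (¬ ∃ k l : ℤ, k ≠ 0 ∧ l ≠ 0 ∧ IsConj (w c.1 ^ k) (w c.2 ^ l)) →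
          p ∣ orderOf (φ (w c.1)) ∧ orderOf (φ (w c.2)) ∣ m) := by
    intro c
    by_cases h : w c.1 ≠ 1 ∧ w c.2 ≠ 1 ∧
        ¬ ∃ k l : ℤ, k ≠ 0 ∧ l ≠ 0 ∧ IsConj (w c.1 ^ k) (w c.2 ^ l)
    · obtain ⟨m, hm, hmp⟩ := exists_prime_dvd_orderOf h.1 h.2.1
        fun k l hk hl hkl => h.2.2 ⟨k, l, hk, hl, hkl⟩
      refine ⟨m, hm, fun p hp => ?_⟩
      obtain ⟨H, hH, hfin, φ, h1, h2⟩ := hmp p hp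
      exact ⟨H, hH, hfin, φ, h1, fun _ _ _ => h2⟩
    · exact ⟨1, one_pos, fun p _ => ⟨PUnit, inferInstance, inferInstance, 1, by simp,
        fun h1 h2 h3 => absurd ⟨h1, h2, h3⟩ h⟩⟩
  choose m hm hmp using hpair
  let p : ι × ι → ℕ := fun c =>
    Nat.nth Nat.Prime (Nat.card H₀ + ∑ c, m c + Fintype.equivFin (ι × ι) c)
  have hp : ∀ c, (p c).Prime := fun c => Nat.prime_nth_prime _
  have hpinj : ∀ c d, p c = p d → c = d := by
    intro c d h
    have h' := Nat.nth_injective Nat.infinite_setOfPred_prime h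
    exact (Fintype.equivFin (ι × ι)).injective (Fin.ext (Nat.add_left_cancel h'))
  have hlt : ∀ c, Nat.card H₀ + ∑ c, m c < p c := fun c =>
    lt_of_lt_of_le (by omega) (Nat.add_two_le_nth_prime _)
  choose H hH hfin φ hφ hφ' using fun c => hmp c (p c) (hp c)
  let Φ : FreeGroup α →* H₀ × ∀ c, H c := φ₀.prod (MonoidHom.pi φ)
  have hK : ∀ i, w i ≠ 1 → K ∣ orderOf (Φ (w i)) := fun i hi =>
    (hφ₀ _ ⟨i, rfl⟩ hi).trans (orderOf_map_dvd (MonoidHom.fst H₀ (∀ c, H c)) (Φ (w i)))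
  have hne_one : ∀ i j, w i = 1 → w j ≠ 1 → orderOf (Φ (w i)) ≠ orderOf (Φ (w j)) := by
    intro i j hi hj h
    have h1 := hK j hj
    rw [← h, hi, _root_.map_one, orderOf_one] at h1
    have h2 : (2 : ℕ) ∣ 1 := (Dvd.intro _ hKdef.symm).trans h1
    omega
  refine ⟨H₀ × ∀ c, H c, inferInstance, inferInstance, Φ, fun i j hij heq => ?_⟩
  by_cases hi : w i = 1
  · by_cases hj : w j = 1
    · exact (hw i j hij).1 (by rw [hi, hj])
    · exact hne_one i j hi hj heq
  by_cases hj : w j = 1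
  · exact hne_one j i hj hi heq.symm
  by_cases hcom : ∃ k l : ℤ, k ≠ 0 ∧ l ≠ 0 ∧ IsConj (w i ^ k) (w j ^ l)
  · rcases isConj_or_isConj_inv_of_orderOf_eq (hk (i, j)) (hkl (i, j) hcom) Φ
      (((Dvd.intro _ rfl).trans (hdvdK _)).trans (hK i hi))
      (((Dvd.intro_left _ rfl).trans (hdvdK _)).trans (hK j hj)) heq with h | h
    · exact (hw i j hij).1 h
    · exact (hw i j hij).2 h
  · obtain ⟨h1, h2⟩ := hφ' (i, j) hi hj hcom
    have h3 : p (i, j) ∣ orderOf (Φ (w i)) := h1.trans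
      (orderOf_map_dvd ((Pi.evalMonoidHom H (i, j)).comp (MonoidHom.snd H₀ _)) (Φ (w i)))
    let e : ι × ι → ℕ := fun c => if c = (i, j) then m c else m c * p c
    have he : ∀ c, orderOf (φ c (w j)) ∣ e c := by
      intro c
      by_cases hc : c = (i, j)
      · subst hc
        simpa [e] using h2
      · simpa [e, hc] using hφ c (w j)
    have h4 : orderOf (Φ (w j)) ∣ Nat.card H₀ * ∏ c, e c := by
      refine orderOf_dvd_of_pow_eq_one (Prod.ext ?_ (funext fun c => ?_))
      · change φ₀ (w j) ^ _ = 1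
        rw [pow_mul, pow_card_eq_one', one_pow]
      · change φ c (w j) ^ _ = 1
        exact orderOf_dvd_iff_pow_eq_one.1
          (((he c).trans (Finset.dvd_prod_of_mem e (Finset.mem_univ c))).mul_left _)
    have hsmall : ∀ x, 0 < x → x ≤ Nat.card H₀ + ∑ c, m c → ¬ p (i, j) ∣ x := fun x hx hle hdvd =>
      ((Nat.le_of_dvd hx hdvd).trans hle).not_gt (hlt _)
    have hmle : ∀ c, ¬ p (i, j) ∣ m c := fun c => hsmall _ (hm c)
      ((Finset.single_le_sum (fun _ _ => Nat.zero_le _) (Finset.mem_univ c)).trans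
        (Nat.le_add_left _ _))
    rw [heq] at h3
    rcases (hp (i, j)).dvd_mul.1 (h3.trans h4) with h5 | h5
    · exact hsmall _ Nat.card_pos (Nat.le_add_right _ _) h5
    · obtain ⟨c, -, hc⟩ := ((hp (i, j)).prime.dvd_finsetProd_iff e).1 h5
      by_cases hcij : c = (i, j)
      · simp only [e, if_pos hcij] at hc
        exact hmle c hc
      · simp only [e, if_neg hcij] at hc
        rcases (hp (i, j)).dvd_mul.1 hc with h6 | h6
        · exact hmle c h6
        · exact hcij (hpinj _ _ ((Nat.prime_dvd_prime_iff_eq (hp _) (hp _)).1 h6)).symm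

end FreeGroup

/-- Any absolutely free group is `n`-element order separable for each positive `n`. -/
theorem freeGroup_orderSeparable (α : Type*) (n : ℕ) (hn : 0 < n) :
    OrderSeparable (FreeGroup α) n := by
  intro w hw
  obtain ⟨H, hH, hfin, φ, hφ⟩ := FreeGroup.exists_finite_orderOf_ne w hw
  obtain ⟨N, ⟨e⟩⟩ := Finite.exists_equiv_fin H
  let ψ : H →* Equiv.Perm (Fin N) :=
    e.permCongrHom.toMonoidHom.comp (MulAction.toPermHom H H)
  have hψ : Function.Injective ψ := e.permCongrHom.injective.comp MulAction.toPerm_injective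
  refine ⟨(ψ.comp φ).range, inferInstance, inferInstance, (ψ.comp φ).rangeRestrict,
    (ψ.comp φ).rangeRestrict_surjective, fun i j hij => ?_⟩
  have hord : ∀ f, orderOf ((ψ.comp φ).rangeRestrict f) = orderOf (φ f) := fun f => by
    rw [← Subgroup.orderOf_coe, ← orderOf_injective ψ hψ]
    rfl
  rw [hord, hord]
  exact hφ i j hij
end

section
/- Let A and B be groups that are periodic (every element has finite order) and n-element order separable for every positive integer n. If |a| ≠ |b| for every nontrivial a ∈ A and every nontrivial b ∈ B, then the free product A ∗ B is n-element order separable for every positive integer n. -/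
namespace FreeProductOrder

open Monoid.Coprod

section NormalForm

variable {A B : Type*} [Group A] [Group B]

/-- The syllable pairs `a b` with `a` and `b` nontrivial. -/
abbrev Syll (A B : Type*) [Group A] [Group B] := {a : A // a ≠ 1} × {b : B // b ≠ 1}

/-- The element `a₁ b₁ ⋯ aₗ bₗ` of the free product. -/
def eval (L : List (Syll A B)) : Monoid.Coprod A B :=
  (L.map fun p => inl p.1.1 * inr p.2.1).prod

@[simp] lemma eval_nil : eval ([] : List (Syll A B)) = 1 := rfl

@[simp] lemma eval_cons (p : Syll A B) (L : List (Syll A B)) :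
    eval (p :: L) = inl p.1.1 * inr p.2.1 * eval L := by
  simp [eval]

lemma eval_append (L M : List (Syll A B)) : eval (L ++ M) = eval L * eval M := by
  simp [eval]

/-- Normal forms `b (a₁ b₁ ⋯ aₗ bₗ) a`. -/
abbrev NF (A B : Type*) [Group A] [Group B] := B × List (Syll A B) × A

/-- The element of the free product with the given normal form. -/
def NF.val (x : NF A B) : Monoid.Coprod A B := inr x.1 * eval x.2.1 * inl x.2.2

/-- The indicator of nontriviality. -/
noncomputable def ind {C : Type*} [Group C] (c : C) : ℕ := open Classical in if c = 1 then 0 else 1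

@[simp] lemma ind_one {C : Type*} [Group C] : ind (1 : C) = 0 := if_pos rfl

lemma ind_of_ne {C : Type*} [Group C] {c : C} (h : c ≠ 1) : ind c = 1 := if_neg h

lemma ind_le_one {C : Type*} [Group C] (c : C) : ind c ≤ 1 := by
  unfold ind; split_ifs <;> simp

/-- The number of syllables of a normal form. -/
noncomputable def NF.len (x : NF A B) : ℕ := ind x.1 + 2 * x.2.1.length + ind x.2.2

open Classical in
/-- Left multiplication of normal forms by elements of `A`. -/
noncomputable def actA (a : A) : NF A B → NF A B
  | (b, L, c) =>
    if hb : b = 1 then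
      match L with
      | [] => (1, [], a * c)
      | (a₁, b₁) :: L' =>
        if h : a * a₁.1 = 1 then (b₁.1, L', c) else (1, (⟨a * a₁.1, h⟩, b₁) :: L', c)
    else if ha : a = 1 then (b, L, c) else (1, (⟨a, ha⟩, ⟨b, hb⟩) :: L, c)

lemma actA_one (x : NF A B) : actA 1 x = x := by
  obtain ⟨b, L, c⟩ := x
  by_cases hb : b = 1
  · subst hb
    rcases L with _ | ⟨⟨a₁, b₁⟩, L⟩
    · simp [actA]
    · simp [actA, a₁.2]
  · simp [actA, hb]

lemma actA_mul (a a' : A) (x : NF A B) : actA (a * a') x = actA a (actA a' x) := by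
  obtain ⟨b, L, c⟩ := x
  by_cases hb : b = 1
  · subst hb
    rcases L with _ | ⟨⟨a₁, b₁⟩, L⟩
    · simp [actA, mul_assoc]
    · by_cases h : a' * a₁.1 = 1
      · by_cases ha : a = 1
        · subst ha; simp [actA, h, b₁.2]
        · simp [actA, h, mul_assoc, b₁.2, ha]
      · by_cases h2 : a * (a' * a₁.1) = 1 <;> simp [actA, h, h2, mul_assoc]
  · by_cases ha' : a' = 1
    · subst ha'; by_cases ha : a = 1 <;> simp [actA, hb, ha]
    · by_cases h : a * a' = 1 <;> simp [actA, hb, ha', h]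

/-- The homomorphism to permutations given by an action. -/
def permHom {C X : Type*} [Group C] (f : C → X → X) (h1 : ∀ x, f 1 x = x)
    (hm : ∀ c d x, f (c * d) x = f c (f d x)) : C →* Equiv.Perm X :=
  MonoidHom.mk'
    (fun c =>
      { toFun := f c
        invFun := f c⁻¹
        left_inv := fun x => by rw [← hm, inv_mul_cancel, h1]
        right_inv := fun x => by rw [← hm, mul_inv_cancel, h1] })
    fun c d => Equiv.ext (hm c d)

@[simp] lemma permHom_apply {C X : Type*} [Group C] (f : C → X → X) (h1 : ∀ x, f 1 x = x)
    (hm : ∀ c d x, f (c * d) x = f c (f d x)) (c : C) (x : X) : permHom f h1 hm c x = f c x :=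
  rfl

/-- The free product acts on normal forms. -/
noncomputable def act : Monoid.Coprod A B →* Equiv.Perm (NF A B) :=
  Monoid.Coprod.lift (permHom actA actA_one actA_mul)
    (permHom (fun b x => (b * x.1, x.2)) (fun x => by simp) fun b c x => by simp [mul_assoc])

lemma act_inl (a : A) (x : NF A B) : act (inl a) x = actA a x := by
  simp [act]

lemma act_inr (b : B) (x : NF A B) : act (inr b) x = (b * x.1, x.2) := by
  simp [act]

lemma val_actA (a : A) (x : NF A B) : (actA a x).val = inl a * x.val := by
  obtain ⟨b, L, c⟩ := x
  by_cases hb : b = 1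
  · subst hb
    rcases L with _ | ⟨⟨a₁, b₁⟩, L⟩
    · simp [actA, NF.val]
    · by_cases h : a * a₁.1 = 1
      · have h' : (inl a * inl a₁.1 : Monoid.Coprod A B) = 1 := by rw [← map_mul, h, map_one]
        simp [actA, NF.val, h, ← mul_assoc, h']
      · simp [actA, NF.val, h, mul_assoc]
  · by_cases ha : a = 1
    · subst ha; simp [actA, NF.val, hb]
    · simp [actA, NF.val, hb, ha, mul_assoc]

lemma val_act (g : Monoid.Coprod A B) : ∀ x : NF A B, (act g x).val = g * x.val := by
  induction g using Monoid.Coprod.induction_on with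
  | inl a => intro x; rw [act_inl, val_actA]
  | inr b => intro x; simp [act_inr, NF.val, mul_assoc]
  | mul g h hg hh => intro x; rw [map_mul, Equiv.Perm.mul_apply, hg, hh, mul_assoc]

lemma act_eval (L : List (Syll A B)) (M : List (Syll A B)) (c : A) :
    act (eval L) (1, M, c) = (1, L ++ M, c) := by
  induction L with
  | nil => simp
  | cons p L ih =>
    simp [eval_cons, Equiv.Perm.mul_apply, ih, act_inl, act_inr, actA, p.1.2, p.2.2]

lemma act_val (x : NF A B) : act x.val (1, [], 1) = x := by
  obtain ⟨b, L, c⟩ := x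
  simp [NF.val, Equiv.Perm.mul_apply, act_inl, actA, act_eval, act_inr]

lemma val_injective : Function.Injective (NF.val : NF A B → Monoid.Coprod A B) := by
  intro x y h
  rw [← act_val x, h, act_val]

lemma exists_val (g : Monoid.Coprod A B) : ∃ x : NF A B, x.val = g :=
  ⟨act g (1, [], 1), by rw [val_act]; simp [NF.val]⟩

/-- The syllable length of an element of the free product. -/
noncomputable def len (g : Monoid.Coprod A B) : ℕ := (act g (1, [], 1)).len

lemma len_val (x : NF A B) : len x.val = x.len := by rw [len, act_val]

lemma len_inl_mul (a : A) (g : Monoid.Coprod A B) : len (inl a * g) ≤ len g + 1 := by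
  rw [len, len, map_mul, Equiv.Perm.mul_apply, act_inl]
  generalize act g (1, [], 1) = x
  obtain ⟨b, L, c⟩ := x
  by_cases hb : b = 1
  · subst hb
    rcases L with _ | ⟨⟨a₁, b₁⟩, L⟩
    · have := ind_le_one (a * c)
      simp [actA, NF.len]; omega
    · by_cases h : a * a₁.1 = 1
      · simp [actA, NF.len, h, ind_of_ne b₁.2]; omega
      · simp [actA, NF.len, h]
  · by_cases ha : a = 1
    · subst ha; simp [actA, NF.len, hb]
    · simp [actA, NF.len, hb, ha, ind_of_ne hb]; omega

lemma len_inr_mul (b : B) (g : Monoid.Coprod A B) : len (inr b * g) ≤ len g + 1 := by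
  rw [len, len, map_mul, Equiv.Perm.mul_apply, act_inr]
  generalize act g (1, [], 1) = x
  have := ind_le_one (b * x.1)
  simp only [NF.len]; omega

lemma len_eval_mul (L : List (Syll A B)) (g : Monoid.Coprod A B) :
    len (eval L * g) ≤ len g + 2 * L.length := by
  induction L with
  | nil => simp
  | cons p L ih =>
    rw [eval_cons, mul_assoc, mul_assoc]
    have h1 := len_inl_mul p.1.1 (inr p.2.1 * (eval L * g))
    have h2 := len_inr_mul p.2.1 (eval L * g)
    simp only [List.length_cons]; omega

lemma eval_injective : Function.Injective (eval : List (Syll A B) → Monoid.Coprod A B) := by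
  intro L M h
  have : NF.val ((1, L, 1) : NF A B) = NF.val (1, M, 1) := by simp [NF.val, h]
  simpa using val_injective this

lemma len_eq {b : B} {L : List (Syll A B)} {a : A} :
    len (inr b * eval L * inl a) = NF.len (b, L, a) := len_val (b, L, a)

lemma not_commute_eval_mul_inl {Z P : List (Syll A B)} (hZ : Z ≠ []) {a : A} (ha : a ≠ 1) :
    ¬ Commute (eval P * inl a) (eval Z) := by
  intro h
  have h1 : len (eval Z * (eval P * inl a)) = 2 * (Z.length + P.length) + 1 := by
    have := len_eq (b := (1 : B)) (L := Z ++ P) (a := a)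
    simpa [eval_append, NF.len, ind_of_ne ha, mul_assoc] using this
  obtain ⟨p, Z, rfl⟩ := List.exists_cons_of_ne_nil hZ
  have h2 : len (inr p.2.1 * eval Z) = 2 * Z.length + 1 := by
    have := len_eq (b := p.2.1) (L := Z) (a := (1 : A))
    rw [map_one, mul_one] at this
    rw [this]; simp [NF.len, ind_of_ne p.2.2]; omega
  have h3 := len_eval_mul P (inl (a * p.1.1) * (inr p.2.1 * eval Z))
  have h4 := len_inl_mul (a * p.1.1) (inr p.2.1 * eval Z)
  have h5 : eval P * (inl (a * p.1.1) * (inr p.2.1 * eval Z)) = eval P * inl a * eval (p :: Z) := by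
    simp [mul_assoc]
  rw [h5, h.eq, h1] at h3
  simp only [List.length_cons] at h3
  omega

lemma not_commute_inr_mul_eval {Z P : List (Syll A B)} (hZ : Z ≠ []) {b : B} (hb : b ≠ 1) :
    ¬ Commute (inr b * eval P) (eval Z) := by
  intro h
  have h1 : len (inr b * eval P * eval Z) = 2 * (Z.length + P.length) + 1 := by
    have := len_eq (b := b) (L := P ++ Z) (a := (1 : A))
    rw [map_one, mul_one, eval_append, ← mul_assoc] at this
    rw [this]; simp [NF.len, ind_of_ne hb]; omega
  obtain ⟨Z, p, rfl⟩ := List.eq_nil_or_concat' Z |>.resolve_left hZ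
  have h2 : len (eval P) = 2 * P.length := by
    have := len_eq (b := (1 : B)) (L := P) (a := (1 : A))
    simpa [NF.len] using this
  have h3 := len_eval_mul Z (inl p.1.1 * (inr (p.2.1 * b) * eval P))
  have h4 := len_inl_mul p.1.1 (inr (p.2.1 * b) * eval P)
  have h6 := len_inr_mul (p.2.1 * b) (eval P)
  have h5 : eval Z * (inl p.1.1 * (inr (p.2.1 * b) * eval P)) =
      eval (Z ++ [p]) * (inr b * eval P) := by
    simp [mul_assoc, eval_append]
  rw [h5, ← h.eq, h1] at h3
  simp only [List.length_append, List.length_singleton] at h3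
  omega

/-- An element commuting with `a₁ b₁ ⋯ aₗ bₗ` or its inverse has the same shape. -/
lemma exists_eval_of_commute {Z : List (Syll A B)} (hZ : Z ≠ []) {y : Monoid.Coprod A B}
    (h : Commute y (eval Z)) : ∃ Y : List (Syll A B), y = eval Y ∨ y⁻¹ = eval Y := by
  obtain ⟨⟨b, L, a⟩, hx⟩ := exists_val y
  obtain ⟨⟨b', L', a'⟩, hx'⟩ := exists_val y⁻¹
  have key : ∀ (y : Monoid.Coprod A B) (b : B) (L : List (Syll A B)) (a : A),
      Commute y (eval Z) → NF.val (b, L, a) = y →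
      y = eval L ∨ (a ≠ 1 ∧ b ≠ 1) := by
    intro y b L a h hx
    by_cases ha : a = 1
    · by_cases hb : b = 1
      · left; simp [← hx, ha, hb, NF.val]
      · subst ha; simp only [NF.val, map_one, mul_one] at hx
        exact absurd (hx ▸ h) (not_commute_inr_mul_eval hZ hb)
    · by_cases hb : b = 1
      · subst hb; simp only [NF.val, map_one, one_mul] at hx
        exact absurd (hx ▸ h) (not_commute_eval_mul_inl hZ ha)
      · exact Or.inr ⟨ha, hb⟩
  rcases key y b L a h hx with h1 | ⟨ha, hb⟩
  · exact ⟨L, Or.inl h1⟩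
  rcases key y⁻¹ b' L' a' h.inv_left hx' with h1 | ⟨ha', hb'⟩
  · exact ⟨L', Or.inr h1⟩
  exfalso
  have h1 : NF.val (b, L ++ (⟨a, ha⟩, ⟨b', hb'⟩) :: L', a') = NF.val ((1, [], 1) : NF A B) := by
    have : y * y⁻¹ = 1 := mul_inv_cancel y
    rw [← hx', ← hx] at this
    simpa [NF.val, eval_append, mul_assoc] using this
  simpa using val_injective h1

lemma eval_flatten_replicate (L : List (Syll A B)) (n : ℕ) :
    eval (List.replicate n L).flatten = eval L ^ n := by
  induction n with
  | zero => simp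
  | succ n ih => simp [List.replicate_succ, eval_append, ih, pow_succ']

lemma eval_ne_one {L : List (Syll A B)} (hL : L ≠ []) : eval L ≠ 1 := fun h =>
  hL (eval_injective (by simpa using h))

lemma eval_pow_ne_one {L : List (Syll A B)} (hL : L ≠ []) {n : ℕ} (hn : n ≠ 0) :
    eval L ^ n ≠ 1 := by
  rw [← eval_flatten_replicate]
  apply eval_ne_one
  simp [hL, hn]

/-- Commuting alternating words have a common power. -/
lemma eval_pow_eq_of_commute {Y Z : List (Syll A B)} (h : Commute (eval Y) (eval Z)) :
    eval Y ^ Z.length = eval Z ^ Y.length := by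
  have h' := (h.pow_pow Z.length Y.length).eq
  simp only [← eval_flatten_replicate, ← eval_append] at h' ⊢
  have h2 := List.append_inj (eval_injective h') (by simp [mul_comm])
  rw [h2.1]

/-- Roots of alternating words are unique. -/
lemma eq_of_pow_eq {X : List (Syll A B)} (hX : X ≠ []) {y : Monoid.Coprod A B} {s : ℕ}
    (hs : s ≠ 0) (h : y ^ s = eval X ^ s) : y = eval X := by
  have hc : Commute y (eval (List.replicate s X).flatten) := by
    rw [eval_flatten_replicate, ← h]; exact Commute.self_pow y s
  obtain ⟨Y, hY | hY⟩ := exists_eval_of_commute (by simp [hX, hs]) hc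
  · subst hY
    have h1 := h
    obtain ⟨s, rfl⟩ := Nat.exists_eq_succ_of_ne_zero hs
    rw [← eval_flatten_replicate, ← eval_flatten_replicate] at h1
    have h2 := eval_injective h1
    have h3 : Y.length = X.length := by
      have := congrArg List.length h2
      simpa using this
    rw [Nat.succ_eq_add_one, List.replicate_succ, List.replicate_succ, List.flatten_cons,
      List.flatten_cons] at h2
    rw [(List.append_inj h2 h3).1]
  · exfalso
    have h1 : eval ((List.replicate s Y).flatten ++ (List.replicate s X).flatten) = 1 := by
      rw [eval_append, eval_flatten_replicate, eval_flatten_replicate, ← hY, ← h, inv_pow,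
        inv_mul_cancel]
    have h2 := eval_injective (h1.trans eval_nil.symm)
    simp [hX, hs] at h2

/-- Every element of a free product is conjugate to an element of a factor or to a cyclically
reduced word. -/
lemma exists_isConj (g : Monoid.Coprod A B) :
    (∃ a, IsConj g (inl a)) ∨ (∃ b, IsConj g (inr b)) ∨
      ∃ L : List (Syll A B), L ≠ [] ∧ IsConj g (eval L) := by
  obtain ⟨⟨b, L, a⟩, rfl⟩ := exists_val g
  induction hn : L.length using Nat.strong_induction_on generalizing a b L with
  | _ n ih =>
  subst hn
  have swap : ∀ x y : Monoid.Coprod A B, IsConj (x * y) (y * x) := fun x y =>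
    isConj_iff.2 ⟨y, by group⟩
  by_cases ha : a = 1
  · subst ha
    rcases List.eq_nil_or_concat' L with rfl | ⟨M, p, rfl⟩
    · right; left; exact ⟨b, by
        simp only [NF.val, eval_nil, map_one, mul_one]; exact IsConj.refl _⟩
    · have h1 : IsConj (NF.val (b, M ++ [p], 1)) (eval M * inl p.1.1 * inr (p.2.1 * b)) := by
        have := swap (inr b) (eval (M ++ [p]))
        simpa [NF.val, eval_append, mul_assoc] using this
      by_cases hb : p.2.1 * b = 1
      · have h2 := ih M.length (by simp) 1 M p.1.1 rfl
        rw [hb, map_one, mul_one] at h1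
        simp only [NF.val, map_one, one_mul] at h2
        exact h2.imp (fun ⟨a, h⟩ => ⟨a, h1.trans h⟩)
          (Or.imp (fun ⟨a, h⟩ => ⟨a, h1.trans h⟩) fun ⟨a, h0, h⟩ => ⟨a, h0, h1.trans h⟩)
      · right; right
        refine ⟨M ++ [(p.1, ⟨p.2.1 * b, hb⟩)], by simp, ?_⟩
        simpa [eval_append, mul_assoc] using h1
  · by_cases hb : b = 1
    · subst hb
      rcases L with _ | ⟨p, M⟩
      · left; exact ⟨a, by
        simp only [NF.val, eval_nil, map_one, mul_one, one_mul]; exact IsConj.refl _⟩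
      · have h1 : IsConj (NF.val (1, p :: M, a)) (inl (a * p.1.1) * (inr p.2.1 * eval M)) := by
          have := swap (eval (p :: M)) (inl a)
          simpa [NF.val, eval_append, mul_assoc] using this
        by_cases ha : a * p.1.1 = 1
        · have h2 := ih M.length (by simp) p.2.1 M 1 rfl
          rw [ha, map_one, one_mul] at h1
          simp only [NF.val, map_one, mul_one] at h2
          exact h2.imp (fun ⟨a, h⟩ => ⟨a, h1.trans h⟩)
            (Or.imp (fun ⟨a, h⟩ => ⟨a, h1.trans h⟩) fun ⟨a, h0, h⟩ => ⟨a, h0, h1.trans h⟩)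
        · right; right
          refine ⟨(⟨a * p.1.1, ha⟩, p.2) :: M, by simp, ?_⟩
          simpa [mul_assoc] using h1
    · right; right
      refine ⟨L ++ [(⟨a, ha⟩, ⟨b, hb⟩)], by simp, ?_⟩
      have := swap (inr b) (eval L * inl a)
      simpa [NF.val, eval_append, mul_assoc] using this

end NormalForm

section ResidualFiniteness

open scoped Pointwise

variable {A B : Type*} [Group A] [Group B]

lemma exists_map_eval {F K : Type*} [Group F] [Group K] (φ : A →* F) (ψ : B →* K)
    (L : List (Syll A B)) (h : ∀ p ∈ L, φ p.1.1 ≠ 1 ∧ ψ p.2.1 ≠ 1) :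
    ∃ L' : List (Syll F K), L'.length = L.length ∧ Monoid.Coprod.map φ ψ (eval L) = eval L' := by
  induction L with
  | nil => exact ⟨[], by simp⟩
  | cons p L ih =>
    obtain ⟨L', h1, h2⟩ := ih fun q hq => h q (List.mem_cons_of_mem _ hq)
    have hp := h p List.mem_cons_self
    exact ⟨(⟨φ p.1.1, hp.1⟩, ⟨ψ p.2.1, hp.2⟩) :: L', by simp [h1], by simp [h2]⟩

/-- A nontrivial element of a free product survives as soon as finitely many letters do. -/
lemma exists_letters (S : Finset (Monoid.Coprod A B)) :
    ∃ (TA : Finset A) (TB : Finset B), ∀ (F K : Type) [Group F] [Group K] (φ : A →* F)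
      (ψ : B →* K), (∀ a ∈ TA, a ≠ 1 → φ a ≠ 1) → (∀ b ∈ TB, b ≠ 1 → ψ b ≠ 1) →
      ∀ s ∈ S, s ≠ 1 → Monoid.Coprod.map φ ψ s ≠ 1 := by
  classical
  induction S using Finset.induction_on with
  | empty => exact ⟨∅, ∅, by simp⟩
  | insert g S _ ih =>
    obtain ⟨TA, TB, h⟩ := ih
    obtain ⟨⟨b, L, a⟩, rfl⟩ := exists_val g
    refine ⟨insert a (TA ∪ (L.map fun p => p.1.1).toFinset),
      insert b (TB ∪ (L.map fun p => p.2.1).toFinset), ?_⟩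
    intro F K _ _ φ ψ hφ hψ s hs hs1
    rcases Finset.mem_insert.1 hs with rfl | hs
    · obtain ⟨L', hL', hm⟩ := exists_map_eval φ ψ L fun p hp => by
        refine ⟨hφ _ ?_ p.1.2, hψ _ ?_ p.2.2⟩
        · refine Finset.mem_insert_of_mem (Finset.mem_union_right _ ?_)
          exact List.mem_toFinset.2 (List.mem_map.2 ⟨p, hp, rfl⟩)
        · refine Finset.mem_insert_of_mem (Finset.mem_union_right _ ?_)
          exact List.mem_toFinset.2 (List.mem_map.2 ⟨p, hp, rfl⟩)
      intro h1
      have h2 : NF.val (ψ b, L', φ a) = NF.val ((1, [], 1) : NF F K) := by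
        simpa [NF.val, hm] using h1
      have h3 := val_injective h2
      simp only [Prod.mk.injEq] at h3
      obtain ⟨h4, h5, h6⟩ := h3
      have ha : a = 1 := by
        by_contra ha; exact hφ a (Finset.mem_insert_self _ _) ha h6
      have hb : b = 1 := by
        by_contra hb; exact hψ b (Finset.mem_insert_self _ _) hb h4
      have hL : L = [] := by
        rw [h5] at hL'; exact List.length_eq_zero_iff.1 hL'.symm
      subst ha hb hL
      exact hs1 (by simp [NF.val])
    · exact h F K φ ψ
        (fun x hx => hφ x (Finset.mem_insert_of_mem (Finset.mem_union_left _ hx)))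
        (fun x hx => hψ x (Finset.mem_insert_of_mem (Finset.mem_union_left _ hx))) s hs hs1

open Classical in
/-- The partial left multiplication on a subset. -/
noncomputable def partialMul {G C : Type*} [Group G] [Group C] (ι : C →* G) (Y : Set G) (c : C)
    (y : Y) : Y :=
  if h : ∀ c', ι c' * y.1 ∈ Y then ⟨ι c * y.1, h c⟩ else y

lemma partialMul_of_forall {G C : Type*} [Group G] [Group C] (ι : C →* G) (Y : Set G) (c : C)
    (y : Y) (h : ∀ c', ι c' * y.1 ∈ Y) : partialMul ι Y c y = ⟨ι c * y.1, h c⟩ :=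
  dif_pos h

lemma partialMul_one {G C : Type*} [Group G] [Group C] (ι : C →* G) (Y : Set G) (y : Y) :
    partialMul ι Y 1 y = y := by
  unfold partialMul; split_ifs <;> simp

lemma partialMul_mul {G C : Type*} [Group G] [Group C] (ι : C →* G) (Y : Set G) (c d : C)
    (y : Y) : partialMul ι Y (c * d) y = partialMul ι Y c (partialMul ι Y d y) := by
  by_cases h : ∀ c', ι c' * y.1 ∈ Y
  · rw [partialMul_of_forall ι Y _ y h, partialMul_of_forall ι Y _ y h, partialMul_of_forall]
    · simp [mul_assoc]
    · intro c'
      simpa [mul_assoc] using h (c' * d)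
  · have h2 : ∀ c, partialMul ι Y c y = y := fun c => dif_neg h
    rw [h2, h2, h2]

/-- Free products of finite groups are residually finite. -/
lemma exists_finite_quotient {F K : Type} [Group F] [Group K] [Finite F] [Finite K]
    (S : Finset (Monoid.Coprod F K)) :
    ∃ (Q : Type) (_ : Group Q) (_ : Finite Q) (θ : Monoid.Coprod F K →* Q),
      ∀ s ∈ S, s ≠ 1 → θ s ≠ 1 := by
  let Γ : Set (Monoid.Coprod F K) :=
    Set.range (inl : F →* Monoid.Coprod F K) ∪ Set.range (inr : K →* Monoid.Coprod F K)
  have hl : ∀ f : F, (inl f : Monoid.Coprod F K) ∈ Γ := fun f => Or.inl ⟨f, rfl⟩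
  have hr : ∀ k : K, (inr k : Monoid.Coprod F K) ∈ Γ := fun k => Or.inr ⟨k, rfl⟩
  have h1 : (1 : Monoid.Coprod F K) ∈ Γ := by simpa using hl 1
  have hfin : ∀ m : ℕ, (Γ ^ m).Finite := by
    have hΓ : Γ.Finite := (Set.finite_range _).union (Set.finite_range _)
    intro m
    induction m with
    | zero => simp
    | succ m ih => rw [pow_succ]; exact ih.mul hΓ
  have hex : ∀ g : Monoid.Coprod F K, ∃ m, g ∈ Γ ^ m := by
    intro g
    induction g using Monoid.Coprod.induction_on with
    | inl a => exact ⟨1, by simpa using hl a⟩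
    | inr b => exact ⟨1, by simpa using hr b⟩
    | mul g h hg hh =>
      obtain ⟨m, hm⟩ := hg
      obtain ⟨n, hn⟩ := hh
      exact ⟨m + n, by rw [pow_add]; exact Set.mul_mem_mul hm hn⟩
  choose d hd using hex
  let N := S.sup d
  let Y : Set (Monoid.Coprod F K) := Γ ^ N
  have hmono : ∀ m ≤ N, Γ ^ m ⊆ Y := fun m hm => Set.pow_subset_pow_right h1 hm
  have : Finite Y := hfin N
  let θ : Monoid.Coprod F K →* Equiv.Perm Y := Monoid.Coprod.lift
    (permHom (partialMul inl Y) (partialMul_one _ _) (partialMul_mul _ _))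
    (permHom (partialMul inr Y) (partialMul_one _ _) (partialMul_mul _ _))
  have key : ∀ m (hm : m ≤ N) g (hg : g ∈ Γ ^ m),
      θ g ⟨1, hmono 0 (Nat.zero_le _) (by simp)⟩ = ⟨g, hmono m hm hg⟩ := by
    intro m
    induction m with
    | zero =>
      intro hm g hg
      have : g = 1 := by simpa using hg
      subst this; simp
    | succ m ih =>
      intro hm g hg
      have hg' := hg
      rw [pow_succ'] at hg'
      obtain ⟨γ, hγ, h, hh, rfl⟩ := hg'
      have hY : ∀ γ ∈ Γ, γ * h ∈ Y := fun γ hγ =>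
        hmono _ hm (by rw [pow_succ']; exact Set.mul_mem_mul hγ hh)
      dsimp only
      rw [map_mul, Equiv.Perm.mul_apply, ih (by omega) h hh]
      rcases hγ with ⟨f, rfl⟩ | ⟨k, rfl⟩
      · simp only [θ, lift_apply_inl, permHom_apply]
        rw [partialMul_of_forall]
        exact fun c => hY _ (hl c)
      · simp only [θ, lift_apply_inr, permHom_apply]
        rw [partialMul_of_forall]
        exact fun c => hY _ (hr c)
  refine ⟨Equiv.Perm Y, inferInstance, inferInstance, θ, fun s hs hs1 h => hs1 ?_⟩
  have := key (d s) (Finset.le_sup hs) s (hd s)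
  rw [h, Equiv.Perm.one_apply, Subtype.mk.injEq] at this
  exact this.symm

end ResidualFiniteness

section Cover

variable {A B X C : Type*} [Group A] [Group B] [AddCommGroup C]

/-- The extension of a permutation action of `A ∗ B` on `X` to `X × C`, in which `A` acts on the
first coordinate only and `B` acts by a conjugate of such an action by the shear defined by `c`. -/
def cover (π : Monoid.Coprod A B →* Equiv.Perm X) (c : X → C) :
    Monoid.Coprod A B →* Equiv.Perm (X × C) :=
  Monoid.Coprod.lift
    (permHom (fun a p => (π (inl a) p.1, p.2)) (fun p => by simp) fun a b p => by simp)
    (permHom (fun b p => (π (inr b) p.1, p.2 + (c (π (inr b) p.1) - c p.1))) (fun p => by simp)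
      fun a b p => by
        rw [map_mul, map_mul, Equiv.Perm.mul_apply, add_assoc, add_comm (_ - c p.1),
          sub_add_sub_cancel])

/-- The displacement of the second coordinate in `cover`. -/
def shift (π : Monoid.Coprod A B →* Equiv.Perm X) (c : X → C) (g : Monoid.Coprod A B) (x : X) : C :=
  (cover π c g (x, 0)).2

variable (π : Monoid.Coprod A B →* Equiv.Perm X) (c : X → C)

lemma cover_inl (a : A) (p : X × C) : cover π c (inl a) p = (π (inl a) p.1, p.2) := by
  simp [cover]

lemma cover_inr (b : B) (p : X × C) :
    cover π c (inr b) p = (π (inr b) p.1, p.2 + (c (π (inr b) p.1) - c p.1)) := by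
  simp [cover]

@[simp] lemma shift_inl (a : A) (x : X) : shift π c (inl a) x = 0 := by
  simp [shift, cover_inl]

@[simp] lemma shift_inr (b : B) (x : X) : shift π c (inr b) x = c (π (inr b) x) - c x := by
  simp [shift, cover_inr]

lemma cover_apply (g : Monoid.Coprod A B) (x : X) (s : C) :
    cover π c g (x, s) = (π g x, s + shift π c g x) := by
  induction g using Monoid.Coprod.induction_on generalizing x s with
  | inl a => simp [cover_inl]
  | inr b => simp [cover_inr]
  | mul g h hg hh =>
    rw [shift, map_mul, Equiv.Perm.mul_apply, Equiv.Perm.mul_apply, hh, hh, hg, hg]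
    simp [add_assoc]

lemma shift_mul (g h : Monoid.Coprod A B) (x : X) :
    shift π c (g * h) x = shift π c g (π h x) + shift π c h x := by
  rw [shift, map_mul, Equiv.Perm.mul_apply, cover_apply, cover_apply]
  simp [add_comm]

@[simp] lemma shift_one (x : X) : shift π c 1 x = 0 := by simp [shift]

lemma shift_pow (g : Monoid.Coprod A B) (n : ℕ) (x : X) :
    shift π c (g ^ n) x = ∑ m ∈ Finset.range n, shift π c g (π (g ^ m) x) := by
  induction n with
  | zero => simp
  | succ n ih => rw [pow_succ', shift_mul, ih, Finset.sum_range_succ, add_comm]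

lemma shift_pow_of_fixed {g : Monoid.Coprod A B} {x : X} (h : π g x = x) (n : ℕ) :
    shift π c (g ^ n) x = n • shift π c g x := by
  have h2 : ∀ m : ℕ, π (g ^ m) x = x := fun m => by
    induction m with
    | zero => simp
    | succ m ih => rw [pow_succ', map_mul, Equiv.Perm.mul_apply, ih, h]
  simp only [shift_pow, h2, Finset.sum_const, Finset.card_range]

lemma orderOf_cover_smul {g : Monoid.Coprod A B} {x : X} {r : ℕ} (h : π (g ^ r) x = x) :
    orderOf (cover π c g) • shift π c (g ^ r) x = 0 := by
  rw [← shift_pow_of_fixed π c h, shift, ← pow_mul, mul_comm, pow_mul, map_pow, map_pow,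
    pow_orderOf_eq_one, one_pow]
  rfl

lemma cover_inl_eq_one {a : A} (h : π (inl a) = 1) : cover π c (inl a) = 1 :=
  Equiv.ext fun p => by simp [cover_inl, h]

lemma cover_inr_eq_one {b : B} (h : π (inr b) = 1) : cover π c (inr b) = 1 :=
  Equiv.ext fun p => by simp [cover_inr, h]

lemma cover_pow_mul_eq_one {g : Monoid.Coprod A B} {m N : ℕ} (h : π g ^ m = 1)
    (hN : ∀ s : C, N • s = 0) : cover π c g ^ (m * N) = 1 := by
  rw [pow_mul, ← map_pow, ← map_pow]
  rw [← map_pow] at h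
  refine Equiv.ext fun ⟨x, s⟩ => ?_
  have hx : π (g ^ m) x = x := by rw [h]; rfl
  rw [cover_apply, shift_pow_of_fixed π c hx, hN, map_pow, h]
  simp

open Classical in
/-- The chain of visits of `g`, started at `x`. -/
noncomputable def chain (g : Monoid.Coprod A B) (x y : X) : ℤ :=
  shift π (fun z => (Pi.single z 1 : X → ℤ)) g x y

lemma chain_mul (g h : Monoid.Coprod A B) (x y : X) :
    chain π (g * h) x y = chain π g (π h x) y + chain π h x y := by
  simp [chain, shift_mul]

@[simp] lemma chain_one (x y : X) : chain π 1 x y = 0 := by simp [chain]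

@[simp] lemma chain_inl (a : A) (x y : X) : chain π (inl a) x y = 0 := by simp [chain]

open Classical in
lemma chain_inr (b : B) (x y : X) :
    chain π (inr b) x y = (if π (inr b) x = y then 1 else 0) - if x = y then 1 else 0 := by
  simp [chain, Pi.single_apply, eq_comm]

lemma chain_pow (g : Monoid.Coprod A B) (n : ℕ) (x y : X) :
    chain π (g ^ n) x y = ∑ m ∈ Finset.range n, chain π g (π (g ^ m) x) y := by
  simp [chain, shift_pow]

lemma shift_eq_sum_chain [Fintype X] (g : Monoid.Coprod A B) (x : X) :
    shift π c g x = ∑ y, chain π g x y • c y := by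
  classical
  induction g using Monoid.Coprod.induction_on generalizing x with
  | inl a => simp
  | inr b => simp [chain_inr, sub_smul, Finset.sum_sub_distrib, ite_smul]
  | mul g h hg hh => simp [shift_mul, chain_mul, add_smul, Finset.sum_add_distrib, hg, hh]

lemma chain_pow_apply_pow {g : Monoid.Coprod A B} {r : ℕ} (h : π (g ^ r) = 1) (m : ℕ) (x y : X) :
    chain π (g ^ r) (π (g ^ m) x) y = chain π (g ^ r) x y := by
  have h1 : chain π (g ^ r * g ^ m) x y = chain π (g ^ m * g ^ r) x y := by
    rw [← pow_add, ← pow_add, add_comm]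
  rw [chain_mul, chain_mul, h, Equiv.Perm.one_apply] at h1
  linarith

lemma sum_shift_fibre [Fintype C] {C' : Type*} [AddCommGroup C'] (c' : X × C → C')
    (h0 : ∀ x, ∑ s, c' (x, s) = 0) (g : Monoid.Coprod A B) (x : X) :
    ∑ s, shift (cover π c) c' g (x, s) = 0 := by
  have key : ∀ (f : X × C → C') (h : Monoid.Coprod A B) (x : X),
      ∑ s, f (cover π c h (x, s)) = ∑ s, f (π h x, s) := by
    intro f h x
    simp only [cover_apply]
    exact Equiv.sum_comp (Equiv.addRight (shift π c h x)) fun s => f (π h x, s)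
  induction g using Monoid.Coprod.induction_on generalizing x with
  | inl a => simp
  | inr b => simp [Finset.sum_sub_distrib, key, h0]
  | mul g h hg hh => simp [shift_mul, Finset.sum_add_distrib, key, hg, hh]

lemma sum_chain_fibre [Fintype C] (g : Monoid.Coprod A B) (x y : X) (t : C) :
    ∑ s, chain (cover π c) g (x, t) (y, s) = chain π g x y := by
  classical
  induction g using Monoid.Coprod.induction_on generalizing x t with
  | inl a => simp
  | inr b =>
    have h : ∀ (x : X) (t : C) [∀ s, Decidable ((x, t) = (y, s))],
        (∑ s, if (x, t) = (y, s) then (1 : ℤ) else 0) = if x = y then 1 else 0 := by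
      intro x t _
      by_cases hx : x = y <;> simp [hx]
    simp only [chain_inr, Finset.sum_sub_distrib, cover_apply]
    exact congrArg₂ _ (@h _ _ fun _ => _) (@h _ _ fun _ => _)
  | mul g h hg hh => simp [chain_mul, Finset.sum_add_distrib, hg, hh, cover_apply]

end Cover

section Positions

variable {A B X : Type*} [Group A] [Group B]

/-- The suffixes of the word `a₁ b₁ ⋯ aₗ bₗ` beginning with a letter of `B`. -/
def odds : List (Syll A B) → List (Monoid.Coprod A B)
  | [] => []
  | p :: L => (inr p.2.1 * eval L) :: odds L

/-- The proper suffixes of the word `a₁ b₁ ⋯ aₗ bₗ` beginning with a letter of `A`. -/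
def evens : List (Syll A B) → List (Monoid.Coprod A B)
  | [] => []
  | _ :: L => eval L :: evens L

lemma exists_of_mem_odds {L : List (Syll A B)} {h : Monoid.Coprod A B} (hh : h ∈ odds L) :
    ∃ (b : B) (P : List (Syll A B)), b ≠ 1 ∧ h = inr b * eval P := by
  induction L with
  | nil => simp [odds] at hh
  | cons p L ih =>
    rcases List.mem_cons.1 hh with rfl | hh
    · exact ⟨_, _, p.2.2, rfl⟩
    · exact ih hh

variable (π : Monoid.Coprod A B →* Equiv.Perm X)

open Classical in
lemma chain_eval_cons (p : Syll A B) (L : List (Syll A B)) (x y : X) :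
    chain π (eval (p :: L)) x y = ((if π (inr p.2.1 * eval L) x = y then 1 else 0) -
      if π (eval L) x = y then 1 else 0) + chain π (eval L) x y := by
  rw [eval_cons, mul_assoc, chain_mul, chain_mul, chain_inl, chain_inr]
  simp [Equiv.Perm.mul_apply]

lemma exists_of_chain_ne_zero {L : List (Syll A B)} {x y : X} (h : chain π (eval L) x y ≠ 0) :
    ∃ g ∈ odds L ++ evens L, π g x = y := by
  classical
  induction L with
  | nil => simp at h
  | cons p L ih =>
    rw [chain_eval_cons] at h
    by_cases h1 : π (inr p.2.1 * eval L) x = y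
    · exact ⟨_, by simp [odds], h1⟩
    by_cases h2 : π (eval L) x = y
    · exact ⟨_, by simp [evens], h2⟩
    rw [if_neg h1, if_neg h2] at h
    obtain ⟨g, hg, hy⟩ := ih (by simpa using h)
    refine ⟨g, ?_, hy⟩
    rcases List.mem_append.1 hg with hg | hg
    · simp [odds, hg]
    · simp [evens, hg]

lemma chain_nonpos {L : List (Syll A B)} {x y : X} (h : ∀ g ∈ odds L, π g x ≠ y) :
    chain π (eval L) x y ≤ 0 := by
  classical
  induction L with
  | nil => simp
  | cons p L ih =>
    rw [chain_eval_cons, if_neg (h _ (by simp [odds]))]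
    have := ih fun g hg => h g (by simp [odds, hg])
    split_ifs <;> linarith

lemma chain_self_neg {L : List (Syll A B)} (hL : L ≠ []) {x : X} (h : ∀ g ∈ odds L, π g x ≠ x) :
    chain π (eval L) x x < 0 := by
  classical
  induction L with
  | nil => exact absurd rfl hL
  | cons p L ih =>
    rw [chain_eval_cons, if_neg (h _ (by simp [odds]))]
    by_cases hL' : L = []
    · subst hL'; simp
    · have := ih hL' fun g hg => h g (by simp [odds, hg])
      split_ifs <;> linarith

end Positions

section RegularCover

variable {A B Q : Type*} [Group A] [Group B] [Group Q]

/-- The permutation action of `A ∗ B` on a quotient by left multiplication. -/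
def reg (θ : Monoid.Coprod A B →* Q) : Monoid.Coprod A B →* Equiv.Perm Q :=
  (MulAction.toPermHom Q Q).comp θ

variable (θ : Monoid.Coprod A B →* Q)

@[simp] lemma reg_apply (g : Monoid.Coprod A B) (x : Q) : reg θ g x = θ g * x := rfl

lemma reg_eq_one {g : Monoid.Coprod A B} (h : θ g = 1) : reg θ g = 1 :=
  Equiv.ext fun x => by simp [h]

lemma chain_reg_mul_right (g : Monoid.Coprod A B) (x y z : Q) :
    chain (reg θ) g (x * z) (y * z) = chain (reg θ) g x y := by
  classical
  induction g using Monoid.Coprod.induction_on generalizing x with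
  | inl a => simp
  | inr b => simp only [chain_inr, reg_apply, ← mul_assoc, mul_left_inj]; congr
  | mul g h hg hh => simp only [chain_mul, reg_apply, ← mul_assoc, hg, hh]

lemma chain_reg_self (g : Monoid.Coprod A B) (x : Q) :
    chain (reg θ) g x x = chain (reg θ) g 1 1 := by
  have := chain_reg_mul_right θ g 1 1 x
  rwa [one_mul] at this

/-- The images of the word in the quotient do not return to the cyclic group it generates. -/
def Embedded (L : List (Syll A B)) : Prop := ∀ h ∈ odds L, ¬ Commute (θ h) (θ (eval L))

variable {θ}

lemma chain_pow_one_one_neg {L : List (Syll A B)} (hL : L ≠ []) (h : Embedded θ L) {r : ℕ}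
    (hr : 0 < r) : chain (reg θ) (eval L ^ r) 1 1 < 0 := by
  rw [chain_pow]
  have h1 : ∀ m : ℕ, ∀ g ∈ odds L, reg θ g (reg θ (eval L ^ m) 1) ≠ 1 := by
    intro m g hg h1
    rw [reg_apply, reg_apply, mul_one, map_pow] at h1
    refine h g hg ?_
    rw [eq_inv_of_mul_eq_one_left h1]
    exact ((Commute.refl _).pow_left m).inv_left
  refine Finset.sum_neg' (fun m _ => chain_nonpos _ (h1 m)) ⟨0, by simpa using hr, ?_⟩
  have := chain_self_neg (reg θ) hL (x := 1) (by simpa using h1 0)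
  simpa using this

lemma exists_chain_mul_ne [Finite Q] {L L' : List (Syll A B)} (hL : L ≠ []) (hL' : L' ≠ [])
    (h : Embedded θ L) (h' : Embedded θ L')
    (hc : ∀ g ∈ odds L' ++ evens L', ∀ k, 0 < k → k ≤ (odds L' ++ evens L').length →
      ¬ Commute (θ (eval L ^ k)) (θ (g * eval L' * g⁻¹))) (x : Q) :
    ∃ y, chain (reg θ) (eval L' ^ Nat.card Q) x y * chain (reg θ) (eval L ^ Nat.card Q) 1 1 ≠
      chain (reg θ) (eval L' ^ Nat.card Q) x 1 * chain (reg θ) (eval L ^ Nat.card Q) 1 y := by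
  by_contra! hcon
  have hr : 0 < Nat.card Q := Nat.card_pos
  have hD := (chain_pow_one_one_neg hL h hr).ne
  have hC := (chain_pow_one_one_neg hL' h' hr).ne
  have hθ : ∀ g, reg θ (g ^ Nat.card Q) = 1 := fun g => reg_eq_one θ (by
    rw [map_pow, pow_card_eq_one'])
  have hx : chain (reg θ) (eval L' ^ Nat.card Q) x 1 ≠ 0 := by
    intro h0
    have := hcon x
    rw [h0, zero_mul, chain_reg_self] at this
    exact mul_ne_zero hC hD this
  have hpow : ∀ m : ℕ, chain (reg θ) (eval L ^ Nat.card Q) 1 (θ (eval L) ^ m) =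
      chain (reg θ) (eval L ^ Nat.card Q) 1 1 := by
    intro m
    rw [← chain_pow_apply_pow (reg θ) (hθ (eval L)) m, reg_apply, mul_one, map_pow,
      chain_reg_self]
  have hne : ∀ m : ℕ, chain (reg θ) (eval L' ^ Nat.card Q) x (θ (eval L) ^ m) ≠ 0 := by
    intro m h0
    have := hcon (θ (eval L) ^ m)
    rw [h0, hpow, zero_mul] at this
    exact mul_ne_zero hx hD this.symm
  have hex : ∀ m : ℕ, ∃ g ∈ odds L' ++ evens L', ∃ j : ℕ,
      θ g * θ (eval L') ^ j * x = θ (eval L) ^ m := by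
    intro m
    have := hne m
    rw [chain_pow] at this
    obtain ⟨j, _, hj⟩ := Finset.exists_ne_zero_of_sum_ne_zero this
    obtain ⟨g, hg, hg'⟩ := exists_of_chain_ne_zero _ hj
    exact ⟨g, hg, j, by rwa [reg_apply, reg_apply, ← mul_assoc, map_pow] at hg'⟩
  choose G hG J hJ using hex
  classical
  obtain ⟨m, hm, m', hm', hmm, hGG⟩ := Finset.exists_ne_map_eq_of_card_lt_of_maps_to
    (s := Finset.range ((odds L' ++ evens L').length + 1))
    (t := (odds L' ++ evens L').toFinset) (f := G)
    (by rw [Finset.card_range]; exact Nat.lt_succ_of_le (List.toFinset_card_le _))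
    (fun m _ => List.mem_toFinset.2 (hG m))
  wlog hlt : m < m' generalizing m m'
  · exact this m' hm' m hm hmm.symm hGG.symm (by omega)
  refine hc (G m) (hG m) (m' - m) (by omega) (by simp at hm'; simp; omega) ?_
  have h1 : θ (eval L) ^ (m' - m) =
      θ (G m) * θ (eval L') ^ J m' * (θ (eval L') ^ J m)⁻¹ * (θ (G m))⁻¹ := by
    rw [pow_sub _ hlt.le, ← hJ m, ← hJ m', hGG]
    group
  rw [map_pow, h1, map_mul, map_mul, map_inv, mul_assoc (θ (G m))]
  have h2 : Commute (θ (eval L') ^ J m' * (θ (eval L') ^ J m)⁻¹) (θ (eval L')) :=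
    (Commute.pow_self _ _).mul_left (Commute.pow_self _ _).inv_left
  rw [Commute, SemiconjBy]
  have h3 := h2.eq
  calc _ = θ (G m) * (θ (eval L') ^ J m' * (θ (eval L') ^ J m)⁻¹ * θ (eval L')) * (θ (G m))⁻¹ := by
        group
    _ = _ := by rw [h3]; group

/-- Finitely many nonzero integral functionals have a common point of nonvanishing. -/
lemma exists_forall_apply_ne_zero {ι M : Type*} [AddCommGroup M] (f : ι → M →+ ℤ) (s : Finset ι)
    (h : ∀ i ∈ s, ∃ m, f i m ≠ 0) : ∃ m, ∀ i ∈ s, f i m ≠ 0 := by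
  classical
  induction s using Finset.induction_on with
  | empty => exact ⟨0, by simp⟩
  | insert a s _ ih =>
    obtain ⟨e, he⟩ := ih fun i hi => h i (Finset.mem_insert_of_mem hi)
    obtain ⟨e', he'⟩ := h a (Finset.mem_insert_self _ _)
    by_cases ha : f a e = 0
    · refine ⟨(1 + ∑ i ∈ s, |f i e'|) • e + e', ?_⟩
      intro i hi
      rw [map_add, map_zsmul, smul_eq_mul]
      rcases Finset.mem_insert.1 hi with rfl | hi
      · rwa [ha, mul_zero, zero_add]
      · intro h0
        have h1 : |f i e'| ≤ ∑ i ∈ s, |f i e'| :=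
          Finset.single_le_sum (f := fun i => |f i e'|) (fun _ _ => abs_nonneg _) hi
        have h2 : |f i e'| = (1 + ∑ i ∈ s, |f i e'|) * |f i e| := by
          rw [eq_neg_of_add_eq_zero_right h0, abs_neg, abs_mul,
            abs_of_pos (a := 1 + ∑ i ∈ s, |f i e'|) (by linarith [abs_nonneg (f i e')])]
        have h3 : 1 ≤ |f i e| := Int.one_le_abs (he i hi)
        nlinarith [abs_nonneg (f i e')]
    · refine ⟨e, fun i hi => ?_⟩
      rcases Finset.mem_insert.1 hi with rfl | hi
      · exact ha
      · exact he i hi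

/-- An integral function annihilating one vector and no member of a family not proportional
to it. -/
lemma exists_annihilator {Q : Type*} [Fintype Q] (D : Q → ℤ) (C : Q → Q → ℤ) (z : Q)
    (h : ∀ x, ∃ y, C x y * D z ≠ C x z * D y) :
    ∃ ε : Q → ℤ, ∑ y, D y * ε y = 0 ∧ ∀ x, ∑ y, C x y * ε y ≠ 0 := by
  classical
  let F : (Q → ℤ) → (Q → ℤ) →+ ℤ := fun v =>
    { toFun := fun ε => ∑ y, v y * ε y
      map_zero' := by simp
      map_add' := fun ε δ => by simp [mul_add, Finset.sum_add_distrib] }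
  obtain ⟨m, hm⟩ := exists_forall_apply_ne_zero
    (fun x => (F (C x)).comp (F D).ker.subtype) Finset.univ (by
      intro x _
      obtain ⟨y, hy⟩ := h x
      refine ⟨⟨Pi.single y (D z) - Pi.single z (D y), ?_⟩, ?_⟩
      · simp [F, AddMonoidHom.mem_ker, mul_sub, Finset.sum_sub_distrib, Pi.single_apply,
          mul_comm]
      · simp [F, mul_sub, Finset.sum_sub_distrib, Pi.single_apply]
        exact sub_ne_zero.2 hy)
  exact ⟨m.1, m.2, fun x => hm x (Finset.mem_univ x)⟩

end RegularCover

section Pieces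

lemma exists_ne_succ {q : ℕ} [NeZero q] (f : ZMod q → ℤ) (h0 : ∑ s, f s ≠ 0)
    (h : (∑ s, f s).natAbs < q) : ∃ s, f s ≠ f (s + 1) := by
  by_contra! hc
  have hconst : ∀ n : ℕ, f (n : ZMod q) = f 0 := by
    intro n
    induction n with
    | zero => simp
    | succ n ih => rw [Nat.cast_succ, ← hc, ih]
  have h1 : ∑ s, f s = q * f 0 := by
    rw [Finset.sum_congr rfl fun s _ => (show f s = f 0 by
      rw [← ZMod.natCast_zmod_val s]; exact hconst _)]
    simp
  have h2 : (q : ℤ) ∣ ∑ s, f s := ⟨_, h1⟩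
  have h3 := Nat.le_of_dvd (Int.natAbs_pos.2 h0) (Int.natCast_dvd.1 h2)
  omega

variable {A B : Type*} {Q : Type} [Group A] [Group B] [Group Q]

lemma exists_dvd_orderOf_cover [Finite Q] (θ : Monoid.Coprod A B →* Q) {L : List (Syll A B)}
    (hL : L ≠ []) (h : Embedded θ L) {W : ℕ} (hW : 0 < W) :
    ∃ (H : Type) (_ : Group H) (_ : Finite H) (ψ : Monoid.Coprod A B →* H),
      (∀ a, θ (inl a) = 1 → ψ (inl a) = 1) ∧ (∀ b, θ (inr b) = 1 → ψ (inr b) = 1) ∧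
      W ∣ orderOf (ψ (eval L)) := by
  classical
  have := Fintype.ofFinite Q
  set D := chain (reg θ) (eval L ^ Nat.card Q) 1 1 with hDdef
  have hD : D ≠ 0 := (chain_pow_one_one_neg hL h Nat.card_pos).ne
  have hD' : 0 < D.natAbs := Int.natAbs_pos.2 hD
  have : NeZero (W * D.natAbs) := ⟨(Nat.mul_pos hW hD').ne'⟩
  let c : Q → ZMod (W * D.natAbs) := Pi.single 1 1
  refine ⟨Equiv.Perm (Q × ZMod (W * D.natAbs)), inferInstance, inferInstance, cover (reg θ) c,
    fun a ha => cover_inl_eq_one _ _ (reg_eq_one θ ha),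
    fun b hb => cover_inr_eq_one _ _ (reg_eq_one θ hb), ?_⟩
  have h1 := orderOf_cover_smul (reg θ) c (g := eval L) (x := 1) (r := Nat.card Q)
    (by rw [reg_apply, map_pow, pow_card_eq_one', one_mul])
  rw [shift_eq_sum_chain, Finset.sum_eq_single 1 (by simp +contextual [c]) (by simp), ← hDdef] at h1
  simp only [c, Pi.single_eq_same, zsmul_one, nsmul_eq_mul] at h1
  have h2 : ((orderOf (cover (reg θ) c (eval L)) * D : ℤ) : ZMod (W * D.natAbs)) = 0 := by
    push_cast; exact h1
  rw [ZMod.intCast_zmod_eq_zero_iff_dvd] at h2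
  have h3 := Int.natCast_dvd.1 h2
  rw [Int.natAbs_mul, Int.natAbs_natCast] at h3
  exact Nat.dvd_of_mul_dvd_mul_right hD' h3

lemma exists_separating_prime [Finite Q] (θ : Monoid.Coprod A B →* Q) {L L' : List (Syll A B)}
    (hL : L ≠ []) (hL' : L' ≠ []) (h : Embedded θ L) (h' : Embedded θ L')
    (hc : ∀ g ∈ odds L' ++ evens L', ∀ k, 0 < k → k ≤ (odds L' ++ evens L').length →
      ¬ Commute (θ (eval L ^ k)) (θ (g * eval L' * g⁻¹))) (N : ℕ) :
    ∃ (q P : ℕ) (H : Type) (_ : Group H) (_ : Finite H) (ψ : Monoid.Coprod A B →* H),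
      N < q ∧ N < P ∧ q.Prime ∧ P.Prime ∧ q ≠ P ∧
      (∀ a, θ (inl a) = 1 → ψ (inl a) = 1) ∧ (∀ b, θ (inr b) = 1 → ψ (inr b) = 1) ∧
      (∀ g, ψ g ^ (Nat.card Q * (q * P)) = 1) ∧
      P ∣ orderOf (ψ (eval L)) ∧ ¬ P ∣ orderOf (ψ (eval L')) := by
  classical
  have := Fintype.ofFinite Q
  set r := Nat.card Q with hr
  have hr0 : 0 < r := Nat.card_pos
  obtain ⟨ε, hε, hε'⟩ := exists_annihilator (fun y => chain (reg θ) (eval L ^ r) 1 y)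
    (fun x y => chain (reg θ) (eval L' ^ r) x y) 1 (exists_chain_mul_ne hL hL' h h' hc)
  set D := chain (reg θ) (eval L ^ r) 1 1 with hDdef
  have hD : D ≠ 0 := (chain_pow_one_one_neg hL h hr0).ne
  set e : Q → ℤ := fun x => ∑ y, chain (reg θ) (eval L' ^ r) x y * ε y with he
  obtain ⟨q, hq, hqp⟩ := Nat.exists_infinite_primes (N + D.natAbs + ∑ x, (e x).natAbs + 1)
  have hqf : Fact q.Prime := ⟨hqp⟩
  have hreg : ∀ g, reg θ (g ^ r) = 1 := fun g => reg_eq_one θ (by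
    rw [map_pow, pow_card_eq_one'])
  let c₁ : Q → ZMod q := fun y => (ε y : ZMod q)
  have hs₁ : ∀ g x, shift (reg θ) c₁ g x =
      ((∑ y, chain (reg θ) g x y * ε y : ℤ) : ZMod q) := by
    intro g x
    rw [shift_eq_sum_chain]; simp [c₁]
  set π := cover (reg θ) c₁ with hπ
  have hπL : π (eval L ^ r) (1, 0) = (1, 0) := by
    rw [hπ, cover_apply, hs₁, hε, hreg]; simp
  have he1 : ∀ x, (e x : ZMod q) ≠ 0 := by
    intro x h0
    rw [ZMod.intCast_zmod_eq_zero_iff_dvd] at h0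
    have h1 := Nat.le_of_dvd (Int.natAbs_pos.2 (hε' x)) (Int.natCast_dvd.1 h0)
    have h2 : (e x).natAbs ≤ ∑ x, (e x).natAbs :=
      Finset.single_le_sum (f := fun x => (e x).natAbs) (fun _ _ => Nat.zero_le _)
        (Finset.mem_univ x)
    simp only [he] at h1 h2 hq
    omega
  have hπL' : ∀ x s, π (eval L' ^ r) (x, s) = (x, s + e x) := by
    intro x s
    rw [hπ, cover_apply, hs₁, hreg]; rfl
  have hsum : ∑ s, chain π (eval L ^ r) (1, 0) (1, s) = D := sum_chain_fibre _ _ _ _ _ _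
  obtain ⟨s₀, hs₀⟩ := exists_ne_succ (fun s => chain π (eval L ^ r) (1, 0) (1, s))
    (by rw [hsum]; exact hD) (by rw [hsum]; omega)
  set d := chain π (eval L ^ r) (1, 0) (1, s₀) - chain π (eval L ^ r) (1, 0) (1, s₀ + 1) with hd
  have hd0 : d ≠ 0 := sub_ne_zero.2 hs₀
  obtain ⟨P, hP, hPp⟩ := Nat.exists_infinite_primes (N + d.natAbs + q + r + 1)
  have hPf : Fact P.Prime := ⟨hPp⟩
  let c₂ : Q × ZMod q → ZMod P := Pi.single (1, s₀) 1 - Pi.single (1, s₀ + 1) 1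
  have hπN : ∀ g, π g ^ (r * q) = 1 := fun g => cover_pow_mul_eq_one _ _
    (by rw [← map_pow, hreg]) (by simp)
  refine ⟨q, P, Equiv.Perm ((Q × ZMod q) × ZMod P), inferInstance, inferInstance, cover π c₂,
    by omega, by omega, hqp, hPp, by omega,
    fun a ha => cover_inl_eq_one _ _ (cover_inl_eq_one _ _ (reg_eq_one θ ha)),
    fun b hb => cover_inr_eq_one _ _ (cover_inr_eq_one _ _ (reg_eq_one θ hb)), ?_, ?_, ?_⟩
  · intro g
    rw [← mul_assoc]
    exact cover_pow_mul_eq_one _ _ (hπN g) (by simp)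
  · have h1 := orderOf_cover_smul π c₂ (g := eval L) (x := (1, 0)) (r := r) hπL
    have h2 : shift π c₂ (eval L ^ r) (1, 0) = (d : ZMod P) := by
      rw [shift_eq_sum_chain]
      simp [c₂, Pi.single_apply, mul_sub, Finset.sum_sub_distrib, hd]
    have h3 : (d : ZMod P) ≠ 0 := by
      intro h0
      rw [ZMod.intCast_zmod_eq_zero_iff_dvd] at h0
      have h1 := Nat.le_of_dvd (Int.natAbs_pos.2 hd0) (Int.natCast_dvd.1 h0)
      omega
    rw [h2, nsmul_eq_mul] at h1
    exact (ZMod.natCast_eq_zero_iff _ _).1 ((mul_eq_zero.1 h1).resolve_right h3)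
  · have hfix : ∀ (m : ℕ) x s, π ((eval L' ^ r) ^ m) (x, s) = (x, s + m * e x) := by
      intro m x s
      induction m with
      | zero => simp
      | succ m ih =>
        rw [pow_succ', map_mul, Equiv.Perm.mul_apply, ih, hπL']
        push_cast; ring_nf
    have hz : ∀ z, shift π c₂ ((eval L' ^ r) ^ q) z = 0 := by
      rintro ⟨x, s⟩
      rw [shift_pow]
      simp only [hfix]
      have h0 : ∑ s, shift π c₂ (eval L' ^ r) (x, s) = 0 := by
        refine sum_shift_fibre _ _ _ (fun y => ?_) _ _
        by_cases hy : y = 1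
        · simp [c₂, Pi.single_apply, Finset.sum_sub_distrib, hy]
        · simp [c₂, hy]
      rw [← h0]
      have h1 : ∑ m ∈ Finset.range q, shift π c₂ (eval L' ^ r) (x, s + m * e x) =
          ∑ t : ZMod q, shift π c₂ (eval L' ^ r) (x, s + t * e x) := by
        refine Finset.sum_nbij (fun m : ℕ => (m : ZMod q)) (by simp) ?_ ?_ (by simp)
        · intro m hm m' hm' hmm
          simp only [Finset.coe_range, Set.mem_Iio] at hm hm'
          have := (ZMod.natCast_eq_natCast_iff' m m' q).1 hmm
          rwa [Nat.mod_eq_of_lt hm, Nat.mod_eq_of_lt hm'] at this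
        · intro t _
          exact ⟨t.val, by simpa using ZMod.val_lt t, ZMod.natCast_zmod_val t⟩
      rw [h1]
      exact Equiv.sum_comp ((Equiv.mulRight₀ (e x : ZMod q) (he1 x)).trans (Equiv.addLeft s))
        fun t => shift π c₂ (eval L' ^ r) (x, t)
    have h1 : cover π c₂ (eval L') ^ (r * q) = 1 := by
      rw [← map_pow]
      refine Equiv.ext fun ⟨z, t⟩ => ?_
      rw [cover_apply, pow_mul, hz, ← pow_mul, map_pow, hπN]
      simp
    intro hdvd
    have h2 := hdvd.trans (orderOf_dvd_of_pow_eq_one h1)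
    rcases hPp.dvd_mul.1 h2 with h3 | h3
    · have := Nat.le_of_dvd hr0 h3; omega
    · have := Nat.le_of_dvd hqp.pos h3; omega

end Pieces

section Assembly

open scoped commutatorElement

variable {A B : Type*} [Group A] [Group B]

/-- Some powers of the two words are conjugate up to inversion. -/
def Commensurable (L L' : List (Syll A B)) : Prop :=
  ∃ s t : ℕ, 0 < s ∧ 0 < t ∧
    (IsConj (eval L ^ s) (eval L' ^ t) ∨ IsConj (eval L ^ s) (eval L' ^ t)⁻¹)

lemma commensurable_of_commute {L L' : List (Syll A B)} (hL : L ≠ []) (hL' : L' ≠ [])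
    {k : ℕ} (hk : 0 < k) {g : Monoid.Coprod A B}
    (h : Commute (eval L ^ k) (g * eval L' * g⁻¹)) : Commensurable L L' := by
  have hy : Commute (g⁻¹ * eval L ^ k * g) (eval L') := by
    have h1 := h.eq
    rw [Commute, SemiconjBy]
    calc _ = g⁻¹ * (eval L ^ k * (g * eval L' * g⁻¹)) * g := by group
      _ = _ := by rw [h1]; group
  have hconj : IsConj (eval L ^ (k * L'.length)) ((g⁻¹ * eval L ^ k * g) ^ L'.length) := by
    rw [pow_mul]
    exact IsConj.pow L'.length (isConj_iff.2 ⟨g⁻¹, by group⟩)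
  have hy1 : g⁻¹ * eval L ^ k * g ≠ 1 := by
    intro h1
    refine eval_pow_ne_one hL hk.ne' ?_
    calc eval L ^ k = g * (g⁻¹ * eval L ^ k * g) * g⁻¹ := by group
      _ = 1 := by rw [h1]; group
  have hlen : 0 < k * L'.length := Nat.mul_pos hk (List.length_pos_iff.2 hL')
  obtain ⟨Y, hY | hY⟩ := exists_eval_of_commute hL' hy
  · refine ⟨k * L'.length, Y.length, hlen, List.length_pos_iff.2 ?_, Or.inl ?_⟩
    · rintro rfl; exact hy1 hY
    · rw [hY] at hy hconj
      rwa [← eval_pow_eq_of_commute hy]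
  · refine ⟨k * L'.length, Y.length, hlen, List.length_pos_iff.2 ?_, Or.inr ?_⟩
    · rintro rfl; exact hy1 (inv_eq_one.1 hY)
    · have hy2 := hY ▸ hy.inv_left
      rw [← eval_pow_eq_of_commute hy2, ← hY, inv_pow, inv_inv]
      exact hconj

lemma isConj_of_isConj_pow {g : Monoid.Coprod A B} {L : List (Syll A B)} (hL : L ≠ []) {s : ℕ}
    (hs : 0 < s) (h : IsConj (g ^ s) (eval L ^ s) ∨ IsConj (g ^ s) (eval L ^ s)⁻¹) :
    IsConj g (eval L) ∨ IsConj g (eval L)⁻¹ := by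
  rcases h with h | h
  · obtain ⟨c, hc⟩ := isConj_iff.1 h
    rw [← conj_pow] at hc
    exact Or.inl (isConj_iff.2 ⟨c, eq_of_pow_eq hL hs.ne' hc⟩)
  · obtain ⟨c, hc⟩ := isConj_iff.1 h
    rw [← conj_pow, ← inv_eq_iff_eq_inv, ← inv_pow] at hc
    have := eq_of_pow_eq hL hs.ne' hc
    exact Or.inr (isConj_iff.2 ⟨c, by rw [← this, inv_inv]⟩)

lemma orderOf_map_eq_of_isConj {G H : Type*} [Group G] [Group H] (φ : G →* H) {x y : G}
    (h : IsConj x y ∨ IsConj x y⁻¹) : orderOf (φ x) = orderOf (φ y) := by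
  have key : ∀ x y : G, IsConj x y → orderOf (φ x) = orderOf (φ y) := by
    intro x y h
    obtain ⟨c, rfl⟩ := isConj_iff.1 h
    refine orderOf_eq_orderOf_iff.2 fun n => ?_
    rw [map_mul, map_mul, map_inv, conj_pow, conj_eq_one_iff]
  rcases h with h | h
  · exact key _ _ h
  · rw [key _ _ h, map_inv, orderOf_inv]

lemma orderOf_map_ne_of_isConj_pow {H : Type*} [Group H] [Finite H] (ψ : Monoid.Coprod A B →* H)
    {L L' : List (Syll A B)} (hL' : L' ≠ [])
    (h1 : ¬ IsConj (eval L) (eval L')) (h2 : ¬ IsConj (eval L) (eval L')⁻¹) {s t : ℕ}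
    (hs : 0 < s) (ht : 0 < t)
    (h : IsConj (eval L ^ s) (eval L' ^ t) ∨ IsConj (eval L ^ s) (eval L' ^ t)⁻¹)
    (hsd : s ∣ orderOf (ψ (eval L))) (htd : t ∣ orderOf (ψ (eval L))) :
    orderOf (ψ (eval L)) ≠ orderOf (ψ (eval L')) := by
  intro he
  have h3 := orderOf_map_eq_of_isConj ψ h
  rw [map_pow, map_pow, orderOf_pow_of_dvd hs.ne' hsd, orderOf_pow_of_dvd ht.ne' (he ▸ htd),
    ← he] at h3
  have hst : s = t := by
    obtain ⟨x, hx⟩ := hsd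
    obtain ⟨y, hy⟩ := htd
    have hpos : 0 < orderOf (ψ (eval L)) := orderOf_pos _
    nth_rewrite 1 [hx] at h3
    rw [hy, Nat.mul_div_cancel_left _ hs, Nat.mul_div_cancel_left _ ht] at h3
    subst h3
    rw [hx] at hy hpos
    exact Nat.eq_of_mul_eq_mul_right (Nat.pos_of_mul_pos_left hpos) hy
  subst hst
  rcases isConj_of_isConj_pow hL' hs h with h | h
  · exact h1 h
  · exact h2 h

/-- The equivalence relation of being conjugate up to inversion. -/
def conjInvSetoid (G : Type*) [Group G] : Setoid G where
  r x y := IsConj x y ∨ IsConj x y⁻¹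
  iseqv :=
    { refl := fun x => Or.inl (IsConj.refl x)
      symm := by
        have inv : ∀ x y : G, IsConj x y → IsConj x⁻¹ y⁻¹ := by
          intro x y h
          obtain ⟨c, rfl⟩ := isConj_iff.1 h
          exact isConj_iff.2 ⟨c, by group⟩
        rintro x y (h | h)
        · exact Or.inl h.symm
        · exact Or.inr (by simpa using (inv _ _ h).symm)
      trans := by
        have inv : ∀ x y : G, IsConj x y → IsConj x⁻¹ y⁻¹ := by
          intro x y h
          obtain ⟨c, rfl⟩ := isConj_iff.1 h
          exact isConj_iff.2 ⟨c, by group⟩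
        rintro x y z (h | h) (h' | h')
        · exact Or.inl (h.trans h')
        · exact Or.inr (h.trans h')
        · exact Or.inr (h.trans (inv _ _ h'))
        · exact Or.inl (h.trans (by simpa using inv _ _ h')) }

/-- Order separability separates all members of a finite set simultaneously. -/
lemma exists_hom_of_orderSeparable {G : Type*} [Group G] (h : ∀ n, 0 < n → OrderSeparable G n)
    (T : Finset G) : ∃ (F : Type) (_ : Group F) (_ : Finite F) (φ : G →* F),
      ∀ x ∈ T, ∀ y ∈ T, ¬ IsConj x y → ¬ IsConj x y⁻¹ → orderOf (φ x) ≠ orderOf (φ y) := by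
  classical
  let S := (insert 1 T).image (Quotient.mk (conjInvSetoid G))
  have hS : 0 < S.card := Finset.card_pos.2 ((Finset.insert_nonempty _ _).image _)
  obtain ⟨F, i1, i2, φ, -, hφ⟩ := h S.card hS
    (fun i => Quotient.out (S.equivFin.symm i).1) (by
      intro i j hij
      rw [← not_or]
      intro hc
      have h1 := Quotient.sound (s := conjInvSetoid G) hc
      rw [Quotient.out_eq, Quotient.out_eq] at h1
      exact hij (S.equivFin.symm.injective (Subtype.ext h1)))
  refine ⟨F, i1, i2, φ, fun x hx y hy h1 h2 => ?_⟩
  have hmem : ∀ x ∈ T, Quotient.mk (conjInvSetoid G) x ∈ S := fun x hx =>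
    Finset.mem_image_of_mem _ (Finset.mem_insert_of_mem hx)
  have hne : S.equivFin ⟨_, hmem x hx⟩ ≠ S.equivFin ⟨_, hmem y hy⟩ := by
    intro he
    have h3 := congrArg Subtype.val (S.equivFin.injective he)
    exact (Quotient.exact h3).elim h1 h2
  have h3 := hφ _ _ hne
  have hout : ∀ x, orderOf (φ (Quotient.out (Quotient.mk (conjInvSetoid G) x))) = orderOf (φ x) :=
    fun x => orderOf_map_eq_of_isConj φ (Quotient.mk_out (s := conjInvSetoid G) x)
  simpa only [Equiv.symm_apply_apply, hout] using h3

/-- A common finite quotient of the free product separating given elements of the factors by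
order and preserving noncommutation of given pairs. -/
lemma exists_finite_stage (hA : ∀ n, 0 < n → OrderSeparable A n)
    (hB : ∀ n, 0 < n → OrderSeparable B n) (TA : Finset A) (TB : Finset B)
    (S : Finset (Monoid.Coprod A B × Monoid.Coprod A B)) :
    ∃ (F K Q : Type) (_ : Group F) (_ : Finite F) (_ : Group K) (_ : Finite K) (_ : Group Q)
      (_ : Finite Q) (φ : A →* F) (ψ : B →* K) (θ : Monoid.Coprod A B →* Q),
      (∀ x ∈ TA, ∀ y ∈ TA, ¬ IsConj x y → ¬ IsConj x y⁻¹ → orderOf (φ x) ≠ orderOf (φ y)) ∧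
      (∀ x ∈ TB, ∀ y ∈ TB, ¬ IsConj x y → ¬ IsConj x y⁻¹ → orderOf (ψ x) ≠ orderOf (ψ y)) ∧
      (∀ a, φ a = 1 → θ (inl a) = 1) ∧ (∀ b, ψ b = 1 → θ (inr b) = 1) ∧
      ∀ p ∈ S, Commute (θ p.1) (θ p.2) → Commute p.1 p.2 := by
  classical
  obtain ⟨UA, UB, hU⟩ := exists_letters (S.image fun p => ⁅p.1, p.2⁆)
  obtain ⟨F, _, _, φ, hφ⟩ := exists_hom_of_orderSeparable hA (insert 1 (TA ∪ UA))
  obtain ⟨K, _, _, ψ, hψ⟩ := exists_hom_of_orderSeparable hB (insert 1 (TB ∪ UB))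
  obtain ⟨Q, _, _, θ, hθ⟩ := exists_finite_quotient
    ((S.image fun p => ⁅p.1, p.2⁆).image (Monoid.Coprod.map φ ψ))
  have hmap := hU F K φ ψ
    (fun a ha ha1 h => hφ a (by simp [ha]) 1 (by simp) (by simpa using ha1) (by simpa using ha1)
      (by simp [h]))
    (fun a ha ha1 h => hψ a (by simp [ha]) 1 (by simp) (by simpa using ha1) (by simpa using ha1)
      (by simp [h]))
  refine ⟨F, K, Q, inferInstance, inferInstance, inferInstance, inferInstance, inferInstance,
    inferInstance, φ, ψ, θ.comp (Monoid.Coprod.map φ ψ),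
    fun x hx y hy => hφ x (by simp [hx]) y (by simp [hy]),
    fun x hx y hy => hψ x (by simp [hx]) y (by simp [hy]),
    fun a ha => by simp [ha], fun b hb => by simp [hb], ?_⟩
  intro p hp hc
  rw [← commutatorElement_eq_one_iff_commute] at hc ⊢
  by_contra h1
  have hm := Finset.mem_image_of_mem
    (fun p : Monoid.Coprod A B × Monoid.Coprod A B => ⁅p.1, p.2⁆) hp
  refine hθ _ (Finset.mem_image_of_mem _ hm) (hmap _ hm h1) ?_
  rw [map_commutatorElement, map_commutatorElement]
  exact hc

end Assembly

section Combination

variable {A B : Type*} [Group A] [Group B]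

/-- The homomorphism kills the same elements of the factors as the given homomorphisms. -/
structure SameKernels {F K H : Type*} [Group F] [Group K] [Group H] (φA : A →* F) (φB : B →* K)
    (ψ : Monoid.Coprod A B →* H) : Prop where
  inl_iff : ∀ a, ψ (inl a) = 1 ↔ φA a = 1
  inr_iff : ∀ b, ψ (inr b) = 1 ↔ φB b = 1

variable {F K : Type} [Group F] [Group K] {φA : A →* F} {φB : B →* K}

lemma SameKernels.prod {H H' : Type*} [Group H] [Group H'] {ψ : Monoid.Coprod A B →* H}
    {ψ' : Monoid.Coprod A B →* H'} (h : SameKernels φA φB ψ)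
    (h1 : ∀ a, φA a = 1 → ψ' (inl a) = 1) (h2 : ∀ b, φB b = 1 → ψ' (inr b) = 1) :
    SameKernels φA φB (ψ.prod ψ') where
  inl_iff a := by
    rw [MonoidHom.prod_apply, Prod.mk_eq_one, h.inl_iff]
    exact and_iff_left_of_imp (h1 a)
  inr_iff b := by
    rw [MonoidHom.prod_apply, Prod.mk_eq_one, h.inr_iff]
    exact and_iff_left_of_imp (h2 b)

lemma SameKernels.orderOf_inl {H : Type*} [Group H] {ψ : Monoid.Coprod A B →* H}
    (h : SameKernels φA φB ψ) (a : A) : orderOf (ψ (inl a)) = orderOf (φA a) :=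
  orderOf_eq_orderOf_iff.2 fun n => by
    rw [← map_pow, ← map_pow, ← map_pow, h.inl_iff]

lemma SameKernels.orderOf_inr {H : Type*} [Group H] {ψ : Monoid.Coprod A B →* H}
    (h : SameKernels φA φB ψ) (b : B) : orderOf (ψ (inr b)) = orderOf (φB b) :=
  orderOf_eq_orderOf_iff.2 fun n => by
    rw [← map_pow, ← map_pow, ← map_pow, h.inr_iff]

lemma orderOf_prod_apply {G H H' : Type*} [Group G] [Group H] [Group H'] (ψ : G →* H)
    (ψ' : G →* H') (g : G) :
    orderOf (ψ.prod ψ' g) = (orderOf (ψ g)).lcm (orderOf (ψ' g)) := by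
  rw [MonoidHom.prod_apply, Prod.orderOf_mk]

variable [Finite F] [Finite K]

lemma exists_dvd_orderOf {Q : Type} [Group Q] [Finite Q] (θ : Monoid.Coprod A B →* Q)
    (hθA : ∀ a, φA a = 1 → θ (inl a) = 1) (hθB : ∀ b, φB b = 1 → θ (inr b) = 1)
    {W : ℕ} (hW : 0 < W) (𝓛 : Finset (List (Syll A B))) (h𝓛 : ∀ L ∈ 𝓛, L ≠ [] ∧ Embedded θ L) :
    ∃ (H : Type) (_ : Group H) (_ : Finite H) (ψ : Monoid.Coprod A B →* H),
      SameKernels φA φB ψ ∧ ∀ L ∈ 𝓛, W ∣ orderOf (ψ (eval L)) := by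
  classical
  induction 𝓛 using Finset.induction_on with
  | empty =>
    refine ⟨F × K, inferInstance, inferInstance,
      (Monoid.Coprod.lift φA 1).prod (Monoid.Coprod.lift 1 φB), ⟨fun a => ?_, fun b => ?_⟩,
      by simp⟩ <;> simp
  | insert L 𝓛 _ ih =>
    obtain ⟨H, _, _, ψ, h1, h2⟩ := ih fun L hL => h𝓛 L (Finset.mem_insert_of_mem hL)
    have hL := h𝓛 L (Finset.mem_insert_self _ _)
    obtain ⟨H', _, _, ψ', hA, hB, hW'⟩ := exists_dvd_orderOf_cover θ hL.1 hL.2 hW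
    refine ⟨H × H', inferInstance, inferInstance, ψ.prod ψ',
      h1.prod (fun a ha => hA a (hθA a ha)) (fun b hb => hB b (hθB b hb)), fun M hM => ?_⟩
    rw [orderOf_prod_apply]
    rcases Finset.mem_insert.1 hM with rfl | hM
    · exact hW'.trans (Nat.dvd_lcm_right _ _)
    · exact (h2 M hM).trans (Nat.dvd_lcm_left _ _)

/-- The quotient detects that the two words are not commensurable. -/
def Independent {Q : Type*} [Group Q] (θ : Monoid.Coprod A B →* Q) (L L' : List (Syll A B)) :
    Prop :=
  ∀ g ∈ odds L' ++ evens L', ∀ k, 0 < k → k ≤ (odds L' ++ evens L').length →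
    ¬ Commute (θ (eval L ^ k)) (θ (g * eval L' * g⁻¹))

lemma exists_dvd_orderOf_and_separating {Q : Type} [Group Q] [Finite Q]
    (θ : Monoid.Coprod A B →* Q)
    (hθA : ∀ a, φA a = 1 → θ (inl a) = 1) (hθB : ∀ b, φB b = 1 → θ (inr b) = 1)
    {W : ℕ} (hW : 0 < W) (𝓛 : Finset (List (Syll A B))) (h𝓛 : ∀ L ∈ 𝓛, L ≠ [] ∧ Embedded θ L)
    (𝓟 : Finset (List (Syll A B) × List (Syll A B)))
    (h𝓟 : ∀ p ∈ 𝓟, p.1 ∈ 𝓛 ∧ p.2 ∈ 𝓛 ∧ Independent θ p.1 p.2) :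
    ∃ (H : Type) (_ : Group H) (_ : Finite H) (ψ : Monoid.Coprod A B →* H),
      SameKernels φA φB ψ ∧ (∀ L ∈ 𝓛, W ∣ orderOf (ψ (eval L))) ∧
      ∀ p ∈ 𝓟, ∃ P : ℕ, P.Prime ∧ ¬ P ∣ Nat.card Q ∧ P ∣ orderOf (ψ (eval p.1)) ∧
        ¬ P ∣ orderOf (ψ (eval p.2)) := by
  classical
  induction 𝓟 using Finset.induction_on with
  | empty =>
    obtain ⟨H, i1, i2, ψ, h1, h2⟩ := exists_dvd_orderOf (φA := φA) (φB := φB) θ hθA hθB hW 𝓛 h𝓛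
    exact ⟨H, i1, i2, ψ, h1, h2, by simp⟩
  | insert p 𝓟 _ ih =>
    obtain ⟨H, _, _, ψ, h1, h2, h3⟩ := ih fun p hp => h𝓟 p (Finset.mem_insert_of_mem hp)
    obtain ⟨hp1, hp2, hp⟩ := h𝓟 p (Finset.mem_insert_self _ _)
    obtain ⟨q, P, H', _, _, ψ', hq, hP, hqp, hPp, hqP, hA, hB, hexp, hdvd, hndvd⟩ :=
      exists_separating_prime θ (h𝓛 _ hp1).1 (h𝓛 _ hp2).1 (h𝓛 _ hp1).2 (h𝓛 _ hp2).2 hp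
        (Nat.card H + Nat.card Q)
    have hcard : ∀ R : ℕ, ∀ g, R ∣ orderOf (ψ g) → R ≤ Nat.card H := fun R g hR =>
      Nat.le_of_dvd Nat.card_pos (hR.trans (orderOf_dvd_natCard _))
    refine ⟨H × H', inferInstance, inferInstance, ψ.prod ψ',
      h1.prod (fun a ha => hA a (hθA a ha)) (fun b hb => hB b (hθB b hb)),
      fun L hL => ?_, fun p' hp' => ?_⟩
    · rw [orderOf_prod_apply]
      exact (h2 L hL).trans (Nat.dvd_lcm_left _ _)
    · simp only [orderOf_prod_apply]
      rcases Finset.mem_insert.1 hp' with rfl | hp'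
      · refine ⟨P, hPp, fun h => ?_, hdvd.trans (Nat.dvd_lcm_right _ _), fun h => ?_⟩
        · have := Nat.le_of_dvd Nat.card_pos h; omega
        · rcases hPp.dvd_lcm.1 h with h | h
          · have := hcard _ _ h; omega
          · exact hndvd h
      · obtain ⟨R, hRp, hRQ, hR1, hR2⟩ := h3 p' hp'
        refine ⟨R, hRp, hRQ, hR1.trans (Nat.dvd_lcm_left _ _), fun h => ?_⟩
        have hR := hcard _ _ hR1
        rcases hRp.dvd_lcm.1 h with h | h
        · exact hR2 h
        · have h4 := h.trans (orderOf_dvd_of_pow_eq_one (hexp (eval p'.2)))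
          rcases hRp.dvd_mul.1 h4 with h4 | h4
          · exact hRQ h4
          · rcases hRp.dvd_mul.1 h4 with h4 | h4
            · have := (Nat.prime_dvd_prime_iff_eq hRp hqp).1 h4; omega
            · have := (Nat.prime_dvd_prime_iff_eq hRp hPp).1 h4; omega

end Combination

section Main

variable {A B : Type*} [Group A] [Group B]

lemma exists_large_multiple (𝓛 : Finset (List (Syll A B))) (n : ℕ) :
    ∃ W, n < W ∧ ∀ L ∈ 𝓛, ∀ L' ∈ 𝓛, Commensurable L L' → ∃ s t : ℕ, 0 < s ∧ 0 < t ∧ s ∣ W ∧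
      t ∣ W ∧ (IsConj (eval L ^ s) (eval L' ^ t) ∨ IsConj (eval L ^ s) (eval L' ^ t)⁻¹) := by
  classical
  have hex : ∀ p : List (Syll A B) × List (Syll A B), ∃ m : ℕ, 0 < m ∧
      (Commensurable p.1 p.2 → ∃ s t : ℕ, 0 < s ∧ 0 < t ∧ s ∣ m ∧ t ∣ m ∧
        (IsConj (eval p.1 ^ s) (eval p.2 ^ t) ∨ IsConj (eval p.1 ^ s) (eval p.2 ^ t)⁻¹)) := by
    intro p
    by_cases h : Commensurable p.1 p.2
    · obtain ⟨s, t, hs, ht, hc⟩ := h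
      exact ⟨s * t, Nat.mul_pos hs ht, fun _ =>
        ⟨s, t, hs, ht, Dvd.intro _ rfl, Dvd.intro_left _ rfl, hc⟩⟩
    · exact ⟨1, one_pos, fun h' => absurd h' h⟩
  choose m hm hc using hex
  have hpos : 0 < ∏ p ∈ 𝓛 ×ˢ 𝓛, m p := Finset.prod_pos fun p _ => hm p
  refine ⟨(n + 1) * ∏ p ∈ 𝓛 ×ˢ 𝓛, m p, by nlinarith, fun L hL L' hL' h => ?_⟩
  obtain ⟨s, t, hs, ht, hsm, htm, h⟩ := hc (L, L') h
  have hdvd : m (L, L') ∣ (n + 1) * ∏ p ∈ 𝓛 ×ˢ 𝓛, m p :=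
    (Finset.dvd_prod_of_mem m (Finset.mk_mem_product hL hL')).trans (Dvd.intro_left _ rfl)
  exact ⟨s, t, hs, ht, hsm.trans hdvd, htm.trans hdvd, h⟩

/-- The pairs of elements of a free product whose noncommutation has to be preserved. -/
noncomputable def testPairs (𝓛 : Finset (List (Syll A B))) :
    Finset (Monoid.Coprod A B × Monoid.Coprod A B) := open Classical in
  (𝓛.biUnion fun L => (odds L).toFinset.image fun h => (h, eval L)) ∪
    𝓛.biUnion fun L => 𝓛.biUnion fun L' => (odds L' ++ evens L').toFinset.biUnion fun g =>
      (Finset.range ((odds L' ++ evens L').length + 1)).image fun k =>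
        (eval L ^ k, g * eval L' * g⁻¹)

lemma embedded_of_testPairs {Q : Type*} [Group Q] {θ : Monoid.Coprod A B →* Q}
    {𝓛 : Finset (List (Syll A B))}
    (hS : ∀ p ∈ testPairs 𝓛, Commute (θ p.1) (θ p.2) → Commute p.1 p.2) {L : List (Syll A B)}
    (hL : L ∈ 𝓛) (hne : L ≠ []) : Embedded θ L := by
  classical
  intro h hh hc
  obtain ⟨b, P, hb, rfl⟩ := exists_of_mem_odds hh
  refine not_commute_inr_mul_eval hne hb (P := P) (hS (_, _) (Finset.mem_union_left _ ?_) hc)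
  exact Finset.mem_biUnion.2 ⟨L, hL, Finset.mem_image.2 ⟨_, List.mem_toFinset.2 hh, rfl⟩⟩

lemma independent_of_testPairs {Q : Type*} [Group Q] {θ : Monoid.Coprod A B →* Q}
    {𝓛 : Finset (List (Syll A B))}
    (hS : ∀ p ∈ testPairs 𝓛, Commute (θ p.1) (θ p.2) → Commute p.1 p.2) {L L' : List (Syll A B)}
    (hL : L ∈ 𝓛) (hne : L ≠ []) (hL' : L' ∈ 𝓛) (hne' : L' ≠ []) (h : ¬ Commensurable L L') :
    Independent θ L L' := by
  classical
  intro g hg k hk hk' hc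
  refine h (commensurable_of_commute hne hne' hk (g := g)
    (hS (_, _) (Finset.mem_union_right _ ?_) hc))
  refine Finset.mem_biUnion.2 ⟨L, hL, Finset.mem_biUnion.2 ⟨L', hL', Finset.mem_biUnion.2
    ⟨g, List.mem_toFinset.2 hg, Finset.mem_image.2 ⟨k, ?_, rfl⟩⟩⟩⟩
  exact Finset.mem_range.2 (Nat.lt_succ_of_le hk')

lemma exists_pow_orderOf_eq {G : Type*} [Group G] {x : G} (hx : IsOfFinOrder x) {d : ℕ}
    (hd : d ∣ orderOf x) (hd1 : d ≠ 1) : ∃ y : G, y ≠ 1 ∧ orderOf y = d := by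
  have h := orderOf_pow_orderOf_div hx.orderOf_pos.ne' hd
  refine ⟨_, fun h1 => hd1 ?_, h⟩
  rw [← h, h1, orderOf_one]

lemma orderOf_map_inl_ne_orderOf_map_inr {F K : Type*} [Group F] [Group K]
    (hAper : ∀ a : A, IsOfFinOrder a) (hBper : ∀ b : B, IsOfFinOrder b)
    (hord : ∀ (a : A) (b : B), a ≠ 1 → b ≠ 1 → orderOf a ≠ orderOf b)
    (φ : A →* F) (ψ : B →* K) {a : A} {b : B} (ha : φ a = 1 → a = 1) (hb : ψ b = 1 → b = 1)
    (h : ¬ IsConj (inl a : Monoid.Coprod A B) (inr b)) : orderOf (φ a) ≠ orderOf (ψ b) := by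
  intro he
  by_cases hd : orderOf (φ a) = 1
  · have h1 := ha (orderOf_eq_one_iff.1 hd)
    have h2 := hb (orderOf_eq_one_iff.1 (he ▸ hd))
    subst h1 h2
    exact h (by rw [map_one, map_one])
  · obtain ⟨x, hx, hx'⟩ := exists_pow_orderOf_eq (hAper a) (orderOf_map_dvd φ a) hd
    obtain ⟨y, hy, hy'⟩ := exists_pow_orderOf_eq (hBper b) (orderOf_map_dvd ψ b) (he ▸ hd)
    exact hord x y hx hy (hx'.trans (he.trans hy'.symm))

/-- A finite quotient distinguishing, by orders, finitely many elements of the factors and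
cyclically reduced words. -/
lemma exists_hom_separating (hAper : ∀ a : A, IsOfFinOrder a) (hBper : ∀ b : B, IsOfFinOrder b)
    (hAsep : ∀ n : ℕ, 0 < n → OrderSeparable A n) (hBsep : ∀ n : ℕ, 0 < n → OrderSeparable B n)
    (hord : ∀ (a : A) (b : B), a ≠ 1 → b ≠ 1 → orderOf a ≠ orderOf b)
    (TA : Finset A) (TB : Finset B) (𝓛 : Finset (List (Syll A B))) (h𝓛 : ∀ L ∈ 𝓛, L ≠ [])
    (T : Set (Monoid.Coprod A B))
    (hT : ∀ g ∈ T, (∃ a ∈ TA, g = inl a) ∨ (∃ b ∈ TB, g = inr b) ∨ ∃ L ∈ 𝓛, g = eval L) :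
    ∃ (H : Type) (_ : Group H) (_ : Finite H) (ψ : Monoid.Coprod A B →* H),
      ∀ x ∈ T, ∀ y ∈ T, ¬ IsConj x y → ¬ IsConj x y⁻¹ → orderOf (ψ x) ≠ orderOf (ψ y) := by
  classical
  obtain ⟨F, K, Q, _, _, _, _, _, _, φA, φB, θ, hA, hB, hθA, hθB, hS⟩ :=
    exists_finite_stage hAsep hBsep (insert 1 TA) (insert 1 TB) (testPairs 𝓛)
  obtain ⟨W, hW, hcomm⟩ := exists_large_multiple 𝓛 (Nat.card F + Nat.card K)
  have hemb : ∀ L ∈ 𝓛, L ≠ [] ∧ Embedded θ L := fun L hL =>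
    ⟨h𝓛 L hL, embedded_of_testPairs hS hL (h𝓛 L hL)⟩
  obtain ⟨H, _, _, ψ, hψ, hWdvd, hsep⟩ := exists_dvd_orderOf_and_separating θ hθA hθB
    (Nat.zero_lt_of_lt hW) 𝓛 hemb ((𝓛 ×ˢ 𝓛).filter fun p => ¬ Commensurable p.1 p.2) (by
      intro p hp
      rw [Finset.mem_filter, Finset.mem_product] at hp
      exact ⟨hp.1.1, hp.1.2, independent_of_testPairs hS hp.1.1 (h𝓛 _ hp.1.1) hp.1.2
        (h𝓛 _ hp.1.2) hp.2⟩)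
  have hlarge : ∀ L ∈ 𝓛, Nat.card F + Nat.card K < orderOf (ψ (eval L)) := fun L hL =>
    hW.trans_le (Nat.le_of_dvd (orderOf_pos _) (hWdvd L hL))
  have hFle : ∀ a, orderOf (ψ (inl a)) ≤ Nat.card F := fun a => by
    rw [hψ.orderOf_inl]; exact Nat.le_of_dvd Nat.card_pos (orderOf_dvd_natCard _)
  have hKle : ∀ b, orderOf (ψ (inr b)) ≤ Nat.card K := fun b => by
    rw [hψ.orderOf_inr]; exact Nat.le_of_dvd Nat.card_pos (orderOf_dvd_natCard _)
  have hA1 : ∀ a ∈ TA, φA a = 1 → a = 1 := by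
    intro a ha h1
    by_contra hne
    exact hA a (by simp [ha]) 1 (by simp) (by simpa using hne) (by simpa using hne) (by simp [h1])
  have hB1 : ∀ b ∈ TB, φB b = 1 → b = 1 := by
    intro b hb h1
    by_contra hne
    exact hB b (by simp [hb]) 1 (by simp) (by simpa using hne) (by simpa using hne) (by simp [h1])
  have hAB : ∀ a ∈ TA, ∀ b ∈ TB, ¬ IsConj (inl a : Monoid.Coprod A B) (inr b) →
      orderOf (ψ (inl a)) ≠ orderOf (ψ (inr b)) := by
    intro a ha b hb h
    rw [hψ.orderOf_inl, hψ.orderOf_inr]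
    exact orderOf_map_inl_ne_orderOf_map_inr hAper hBper hord φA φB (hA1 a ha) (hB1 b hb) h
  refine ⟨H, inferInstance, inferInstance, ψ, fun x hx y hy h1 h2 => ?_⟩
  rcases hT x hx with ⟨a, ha, rfl⟩ | ⟨b, hb, rfl⟩ | ⟨L, hL, rfl⟩ <;>
    rcases hT y hy with ⟨a', ha', rfl⟩ | ⟨b', hb', rfl⟩ | ⟨L', hL', rfl⟩
  · rw [hψ.orderOf_inl, hψ.orderOf_inl]
    refine hA a (by simp [ha]) a' (by simp [ha']) (fun h => h1 ?_) fun h => h2 ?_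
    · exact MonoidHom.map_isConj (inl : A →* Monoid.Coprod A B) h
    · rw [← map_inv]; exact MonoidHom.map_isConj (inl : A →* Monoid.Coprod A B) h
  · exact hAB a ha b' hb' h1
  · have := hFle a; have := hlarge L' hL'; omega
  · exact (hAB a' ha' b hb fun h => h1 h.symm).symm
  · rw [hψ.orderOf_inr, hψ.orderOf_inr]
    refine hB b (by simp [hb]) b' (by simp [hb']) (fun h => h1 ?_) fun h => h2 ?_
    · exact MonoidHom.map_isConj (inr : B →* Monoid.Coprod A B) h
    · rw [← map_inv]; exact MonoidHom.map_isConj (inr : B →* Monoid.Coprod A B) h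
  · have := hKle b; have := hlarge L' hL'; omega
  · have := hFle a'; have := hlarge L hL; omega
  · have := hKle b'; have := hlarge L hL; omega
  · by_cases hc : Commensurable L L'
    · obtain ⟨s, t, hs, ht, hsW, htW, hst⟩ := hcomm L hL L' hL' hc
      exact orderOf_map_ne_of_isConj_pow ψ (h𝓛 L' hL') h1 h2 hs ht hst
        (hsW.trans (hWdvd L hL)) (htW.trans (hWdvd L hL))
    · obtain ⟨P, -, -, hP1, hP2⟩ := hsep (L, L') (Finset.mem_filter.2
        ⟨Finset.mk_mem_product hL hL', hc⟩)
      exact fun he => hP2 (he ▸ hP1)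

end Main

end FreeProductOrder

/-- If `A` and `B` are periodic groups that are `n`-element order separable for every
positive `n`, and no nontrivial element of `A` has the same order as a nontrivial element
of `B`, then the free product `A ∗ B` is `n`-element order separable for every positive `n`. -/
theorem coprod_orderSeparable_of_periodic (A B : Type*) [Group A] [Group B]
    (hAper : ∀ a : A, IsOfFinOrder a) (hBper : ∀ b : B, IsOfFinOrder b)
    (hAsep : ∀ n : ℕ, 0 < n → OrderSeparable A n)
    (hBsep : ∀ n : ℕ, 0 < n → OrderSeparable B n)
    (hord : ∀ (a : A) (b : B), a ≠ 1 → b ≠ 1 → orderOf a ≠ orderOf b)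
    (n : ℕ) (hn : 0 < n) :
    OrderSeparable (Monoid.Coprod A B) n := by
  classical
  intro u hu
  have hrep : ∀ i, ∃ (a : A) (b : B) (L : List (FreeProductOrder.Syll A B)) (w : Monoid.Coprod A B),
      IsConj (u i) w ∧
        (w = Monoid.Coprod.inl a ∨ w = Monoid.Coprod.inr b ∨
          (L ≠ [] ∧ w = FreeProductOrder.eval L)) := by
    intro i
    rcases FreeProductOrder.exists_isConj (u i) with ⟨a, h⟩ | ⟨b, h⟩ | ⟨L, hL, h⟩
    · exact ⟨a, 1, [], _, h, Or.inl rfl⟩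
    · exact ⟨1, b, [], _, h, Or.inr (Or.inl rfl)⟩
    · exact ⟨1, 1, L, _, h, Or.inr (Or.inr ⟨hL, rfl⟩)⟩
  choose a b L w hw hcase using hrep
  obtain ⟨H, _, _, ψ, hψ⟩ := FreeProductOrder.exists_hom_separating hAper hBper hAsep hBsep hord
    (Finset.univ.image a) (Finset.univ.image b) ((Finset.univ.image L).filter (· ≠ []))
    (fun M hM => (Finset.mem_filter.1 hM).2) (Set.range w) (by
      rintro _ ⟨i, rfl⟩
      rcases hcase i with h | h | ⟨hL, h⟩
      · exact Or.inl ⟨a i, by simp, h⟩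
      · exact Or.inr (Or.inl ⟨b i, by simp, h⟩)
      · exact Or.inr (Or.inr ⟨L i, by simp [hL], h⟩))
  refine ⟨ψ.range, inferInstance, inferInstance, ψ.rangeRestrict, ψ.rangeRestrict_surjective,
    fun i j hij => ?_⟩
  have horder : ∀ i, orderOf (ψ.rangeRestrict (u i)) = orderOf (ψ (w i)) := fun i => by
    rw [← FreeProductOrder.orderOf_map_eq_of_isConj ψ (Or.inl (hw i)), ← Subgroup.orderOf_coe]; rfl
  rw [horder, horder]
  have hinv : IsConj (u j)⁻¹ (w j)⁻¹ := by
    obtain ⟨c, hc⟩ := isConj_iff.1 (hw j)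
    exact isConj_iff.2 ⟨c, by rw [← hc]; group⟩
  refine hψ _ ⟨i, rfl⟩ _ ⟨j, rfl⟩ (fun h => (hu i j hij).1 ?_) fun h => (hu i j hij).2 ?_
  · exact (hw i).trans (h.trans (hw j).symm)
  · exact (hw i).trans (h.trans hinv.symm)
end
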